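/- arXiv:math/0210143 — 2 statements merged into one kernel-verified Lean document; each statement's English description precedes it below -/
import Mathlib

section
/- Let μ ∈ N be nonzero. Then tr((Ric^{ac}_μ)²)/‖μ‖⁴ ≤ tr((Ric^{ac}_{g.μ})²)/‖g.μ‖⁴ for every g ∈ Sp(n,ℝ) if and only if there exist c ∈ ℝ and D ∈ Der(μ) such that Ric^{ac}_μ = c·I + D. (A compatible metric on an (almost-)symplectic nilpotent Lie group is minimal — it minimizes the norm of the anti-complexified Ricci tensor among compatible metrics with the same scalar curvature — if and only if Ric^{ac} = cI + D with D a derivation.) -/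
open scoped BigOperators
open Matrix

noncomputable section

/-- vectors in `ℝ^m`. -/
abbrev Vec (m : ℕ) := Fin m → ℝ

/-- bilinear-map candidates `ℝ^m × ℝ^m → ℝ^m`. -/
abbrev Bil (m : ℕ) := Vec m → Vec m → Vec m

/-- the `i`-th standard basis vector of `ℝ^m`. -/
def bvec (m : ℕ) (i : Fin m) : Vec m := Pi.single i 1

/-- `μ` is a skew-symmetric bilinear map, i.e. an element of `V = Λ²(ℝ^m)* ⊗ ℝ^m`. -/
def IsSkewBil {m : ℕ} (μ : Bil m) : Prop :=
  (∀ Y, IsLinearMap ℝ fun X => μ X Y) ∧ (∀ X, IsLinearMap ℝ (μ X)) ∧ ∀ X Y, μ X Y = -μ Y X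

/-- the Jacobi identity for `μ`. -/
def IsJacobi {m : ℕ} (μ : Bil m) : Prop :=
  ∀ X Y Z, μ (μ X Y) Z + μ (μ Y Z) X + μ (μ Z X) Y = 0

/-- iterated left multiplications `μ(X (k-1), ⋯ μ(X 0, Y))`. -/
def adPow {m : ℕ} (μ : Bil m) (X : ℕ → Vec m) : ℕ → Vec m → Vec m
  | 0, Y => Y
  | k + 1, Y => μ (X k) (adPow μ X k Y)

/-- nilpotency of the bracket `μ`. -/
def IsNilpotentBil {m : ℕ} (μ : Bil m) : Prop :=
  ∃ k : ℕ, ∀ (X : ℕ → Vec m) (Y : Vec m), adPow μ X k Y = 0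

/-- membership in the variety `N` of nilpotent Lie brackets on `ℝ^m`. -/
def NilBracket {m : ℕ} (μ : Bil m) : Prop :=
  IsSkewBil μ ∧ IsJacobi μ ∧ IsNilpotentBil μ

/-- the `GL_m(ℝ)` action `(g.μ)(X,Y) = g μ(g⁻¹X, g⁻¹Y)` on `V`. -/
def mact {m : ℕ} (g : Matrix (Fin m) (Fin m) ℝ) (μ : Bil m) : Bil m :=
  fun X Y => g.mulVec (μ (g⁻¹.mulVec X) (g⁻¹.mulVec Y))

/-- `‖μ‖²` for the natural inner product on `V`. -/
def normSqV {m : ℕ} (μ : Bil m) : ℝ :=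
  ∑ i, ∑ j, ∑ k, (μ (bvec m i) (bvec m j) k) ^ 2

/-- the Ricci operator of `(N_μ, ⟨·,·⟩)`, as a matrix:
`⟨Ric_μ X, Y⟩ = -(1/2) Σ ⟨μ(X,Xᵢ),Xⱼ⟩⟨μ(Y,Xᵢ),Xⱼ⟩ + (1/4) Σ ⟨μ(Xᵢ,Xⱼ),X⟩⟨μ(Xᵢ,Xⱼ),Y⟩`. -/
def RicM {m : ℕ} (μ : Bil m) : Matrix (Fin m) (Fin m) ℝ :=
  Matrix.of fun x y =>
    -(1/2) * (∑ i, ∑ j, μ (bvec m x) (bvec m i) j * μ (bvec m y) (bvec m i) j)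
    + (1/4) * (∑ i, ∑ j, μ (bvec m i) (bvec m j) x * μ (bvec m i) (bvec m j) y)

/-- `D` is a derivation of the bracket `μ`. -/
def IsDerivation {m : ℕ} (μ : Bil m) (D : Matrix (Fin m) (Fin m) ℝ) : Prop :=
  ∀ X Y, D.mulVec (μ X Y) = μ (D.mulVec X) Y + μ X (D.mulVec Y)

/-- the matrix of `ad_μ X : Y ↦ μ(X,Y)`. -/
def adMat {m : ℕ} (μ : Bil m) (X : Vec m) : Matrix (Fin m) (Fin m) ℝ :=
  Matrix.of fun j i => μ X (bvec m i) j

/-- the moment-map value `M_μ = -4 Σᵢ (ad_μ Xᵢ)ᵗ(ad_μ Xᵢ) + 2 Σᵢ (ad_μ Xᵢ)(ad_μ Xᵢ)ᵗ`. -/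
def Mmat {m : ℕ} (μ : Bil m) : Matrix (Fin m) (Fin m) ℝ :=
  (-4 : ℝ) • (∑ i, (adMat μ (bvec m i))ᵀ * adMat μ (bvec m i))
    + (2 : ℝ) • (∑ i, adMat μ (bvec m i) * (adMat μ (bvec m i))ᵀ)

/-- the 2-form `ω(X,Y) = ⟨X, JY⟩`. -/
def sympForm {m : ℕ} (J : Matrix (Fin m) (Fin m) ℝ) (X Y : Vec m) : ℝ :=
  X ⬝ᵥ J.mulVec Y

/-- closedness of a 2-form `ω` with respect to the bracket `μ`:
`ω(μ(X,Y),Z) + ω(μ(Y,Z),X) + ω(μ(Z,X),Y) = 0`. -/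
def IsClosedForm {m : ℕ} (ω : Vec m → Vec m → ℝ) (μ : Bil m) : Prop :=
  ∀ X Y Z, ω (μ X Y) Z + ω (μ Y Z) X + ω (μ Z X) Y = 0

/-- membership in `Sp(n,ℝ)`: invertible and preserving `ω = ⟨·, J·⟩`. -/
def IsSymplMat {m : ℕ} (J g : Matrix (Fin m) (Fin m) ℝ) : Prop :=
  IsUnit g ∧ ∀ X Y, sympForm J (g.mulVec X) (g.mulVec Y) = sympForm J X Y

/-- membership in `GL(n,ℂ) = {g : gJ = Jg}`. -/
def IsCxMat {m : ℕ} (J g : Matrix (Fin m) (Fin m) ℝ) : Prop :=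
  IsUnit g ∧ g * J = J * g

/-- the anti-complexified Ricci operator `Ric^{ac} = (1/2)(Ric + J Ric J)`. -/
def Ricac {m : ℕ} (J : Matrix (Fin m) (Fin m) ℝ) (μ : Bil m) : Matrix (Fin m) (Fin m) ℝ :=
  (1/2 : ℝ) • (RicM μ + J * RicM μ * J)

/-- the complexified Ricci operator `Ric^{c} = (1/2)(Ric − J Ric J)`. -/
def Ricc {m : ℕ} (J : Matrix (Fin m) (Fin m) ℝ) (μ : Bil m) : Matrix (Fin m) (Fin m) ℝ :=
  (1/2 : ℝ) • (RicM μ - J * RicM μ * J)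

namespace MinSymp

variable {m : ℕ}

lemma expand {μ : Bil m} (h : IsSkewBil μ) (X Y : Vec m) :
    μ X Y = ∑ i, ∑ j, (X i * Y j) • μ (bvec m i) (bvec m j) := by
  obtain ⟨h1, h2, -⟩ := h
  have e : ∀ X : Vec m, X = ∑ i, X i • bvec m i := by
    intro X
    ext k
    simp [bvec, Finset.sum_apply, Pi.single_apply]
  have a1 : ∀ X Y, μ X Y = ∑ i, X i • μ (bvec m i) Y := by
    intro X Y
    have := map_sum (IsLinearMap.mk' _ (h1 Y)) (fun i => X i • bvec m i) Finset.univ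
    rw [← e X] at this
    simpa [(h1 Y).map_smul] using this
  have a2 : ∀ X Y, μ X Y = ∑ i, Y i • μ X (bvec m i) := by
    intro X Y
    have := map_sum (IsLinearMap.mk' _ (h2 X)) (fun i => Y i • bvec m i) Finset.univ
    rw [← e Y] at this
    simpa [(h2 X).map_smul] using this
  rw [a1 X Y]
  refine Finset.sum_congr rfl fun i _ => ?_
  rw [a2 _ Y, Finset.smul_sum]
  simp [smul_smul]

lemma ext_bvec {μ ν : Bil m} (h : IsSkewBil μ) (h' : IsSkewBil ν)
    (H : ∀ i j k, μ (bvec m i) (bvec m j) k = ν (bvec m i) (bvec m j) k) : μ = ν := by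
  funext X Y
  rw [expand h, expand h']
  refine Finset.sum_congr rfl fun i _ => Finset.sum_congr rfl fun j _ => ?_
  congr 1
  ext k
  exact H i j k

lemma skew_mact {μ : Bil m} (h : IsSkewBil μ) (g : Matrix (Fin m) (Fin m) ℝ) :
    IsSkewBil (mact g μ) := by
  obtain ⟨h1, h2, h3⟩ := h
  refine ⟨fun Y => ⟨fun a b => ?_, fun c a => ?_⟩, fun X => ⟨fun a b => ?_, fun c a => ?_⟩, fun X Y => ?_⟩
  · simp only [mact, Matrix.mulVec_add, (h1 _).map_add]
  · simp only [mact, Matrix.mulVec_smul, (h1 _).map_smul]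
  · simp only [mact, Matrix.mulVec_add, (h2 _).map_add]
  · simp only [mact, Matrix.mulVec_smul, (h2 _).map_smul]
  · simp only [mact]
    rw [h3, Matrix.mulVec_neg]

lemma mact_mul (g h : Matrix (Fin m) (Fin m) ℝ) (μ : Bil m) :
    mact (g * h) μ = mact g (mact h μ) := by
  funext X Y
  simp [mact, Matrix.mul_inv_rev, Matrix.mulVec_mulVec]

lemma mact_one (μ : Bil m) : mact 1 μ = μ := by
  funext X Y
  simp [mact]

lemma mact_coord {μ : Bil m} (h : IsSkewBil μ) (g : Matrix (Fin m) (Fin m) ℝ) (a b c : Fin m) :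
    mact g μ (bvec m a) (bvec m b) c =
      ∑ i, ∑ j, ∑ k, g c k * (g⁻¹ i a) * (g⁻¹ j b) * μ (bvec m i) (bvec m j) k := by
  have e1 : ∀ a, g⁻¹ *ᵥ bvec m a = fun i => g⁻¹ i a := by
    intro a
    ext i
    simp [bvec]
  simp only [mact, e1]
  rw [expand h]
  simp only [Matrix.mulVec, dotProduct, Finset.sum_apply, Pi.smul_apply, smul_eq_mul, Finset.mul_sum]
  rw [Finset.sum_comm]
  refine Finset.sum_congr rfl fun i _ => ?_
  rw [Finset.sum_comm]
  refine Finset.sum_congr rfl fun j _ => Finset.sum_congr rfl fun k _ => ?_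
  ring

/-- `R j` is the matrix of `X ↦ μ(X, e_j)`. -/
def Rm (μ : Bil m) (j : Fin m) : Matrix (Fin m) (Fin m) ℝ :=
  Matrix.of fun k i => μ (bvec m i) (bvec m j) k

lemma Ric_eq (μ : Bil m) :
    RicM μ = (-(1/2) : ℝ) • (∑ j, (Rm μ j)ᵀ * Rm μ j) + (1/4 : ℝ) • ∑ j, Rm μ j * (Rm μ j)ᵀ := by
  ext x y
  simp only [RicM, Rm, Matrix.of_apply, Matrix.add_apply, Matrix.smul_apply, Matrix.sum_apply,
    Matrix.mul_apply, Matrix.transpose_apply, smul_eq_mul]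
  congr 2
  rw [Finset.sum_comm]

lemma norm_eq (μ : Bil m) : normSqV μ = ∑ j, Matrix.trace (Rm μ j * (Rm μ j)ᵀ) := by
  simp only [normSqV, Rm, Matrix.trace, Matrix.diag_apply, Matrix.mul_apply, Matrix.of_apply,
    Matrix.transpose_apply]
  rw [Finset.sum_comm]
  refine Finset.sum_congr rfl fun i _ => ?_
  rw [Finset.sum_comm]
  refine Finset.sum_congr rfl fun j _ => Finset.sum_congr rfl fun k _ => ?_
  ring

lemma Rm_mact {μ : Bil m} (h : IsSkewBil μ) {k : Matrix (Fin m) (Fin m) ℝ} (hk : kᵀ * k = 1)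
    (j : Fin m) : Rm (mact k μ) j = ∑ l, k j l • (k * Rm μ l * kᵀ) := by
  have hi : k⁻¹ = kᵀ := Matrix.inv_eq_left_inv hk
  ext c a
  simp only [Rm, Matrix.of_apply, mact_coord h, hi, Matrix.transpose_apply, Matrix.sum_apply,
    Matrix.smul_apply, Matrix.mul_apply, smul_eq_mul, Finset.mul_sum, Finset.sum_mul]
  rw [Finset.sum_comm]
  refine Finset.sum_congr rfl fun i _ => Finset.sum_congr rfl fun j _ =>
    Finset.sum_congr rfl fun k _ => ?_
  ring

/-- change of orthonormal basis in a quadratic sum. -/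
lemma quad_sum {k : Matrix (Fin m) (Fin m) ℝ} (hk : kᵀ * k = 1)
    (A B : Fin m → Matrix (Fin m) (Fin m) ℝ) :
    ∑ j, (∑ l, k j l • A l) * (∑ l, k j l • B l) = ∑ l, A l * B l := by
  have hk' : ∀ l l', ∑ j, k j l * k j l' = if l = l' then 1 else 0 := by
    intro l l'
    have := congrFun (congrFun hk l) l'
    simpa [Matrix.mul_apply, Matrix.one_apply] using this
  simp only [Finset.sum_mul, Finset.mul_sum, Matrix.smul_mul, Matrix.mul_smul, smul_smul]
  rw [Finset.sum_comm]
  refine Finset.sum_congr rfl fun l _ => ?_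
  rw [Finset.sum_comm]
  simp only [← Finset.sum_smul]
  simp [hk']

lemma Ric_mact {μ : Bil m} (h : IsSkewBil μ) {k : Matrix (Fin m) (Fin m) ℝ} (hk : kᵀ * k = 1) :
    RicM (mact k μ) = k * RicM μ * kᵀ := by
  have c : ∀ M N : Matrix (Fin m) (Fin m) ℝ, k * M * kᵀ * (k * N * kᵀ) = k * (M * N) * kᵀ := by
    intro M N
    calc k * M * kᵀ * (k * N * kᵀ) = k * M * (kᵀ * k) * N * kᵀ := by simp only [Matrix.mul_assoc]
      _ = _ := by rw [hk]; simp only [Matrix.mul_assoc, Matrix.one_mul]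
  have t : ∀ M : Matrix (Fin m) (Fin m) ℝ, (k * M * kᵀ)ᵀ = k * Mᵀ * kᵀ := by
    intro M
    simp [Matrix.mul_assoc]
  rw [Ric_eq, Ric_eq]
  simp only [Rm_mact h hk, Matrix.transpose_sum, Matrix.transpose_smul]
  rw [quad_sum hk, quad_sum hk]
  simp only [t, c, Matrix.mul_add, Matrix.add_mul, Matrix.mul_smul, Matrix.smul_mul,
    Finset.mul_sum, Finset.sum_mul]

lemma norm_mact {μ : Bil m} (h : IsSkewBil μ) {k : Matrix (Fin m) (Fin m) ℝ} (hk : kᵀ * k = 1) :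
    normSqV (mact k μ) = normSqV μ := by
  have t : ∀ M : Matrix (Fin m) (Fin m) ℝ, (k * M * kᵀ)ᵀ = k * Mᵀ * kᵀ := by
    intro M
    simp [Matrix.mul_assoc]
  have c : ∀ M N : Matrix (Fin m) (Fin m) ℝ,
      Matrix.trace (k * M * kᵀ * (k * N * kᵀ)) = Matrix.trace (M * N) := by
    intro M N
    calc Matrix.trace (k * M * kᵀ * (k * N * kᵀ)) = Matrix.trace (k * (M * (kᵀ * k) * N * kᵀ)) := by
          simp only [Matrix.mul_assoc]
      _ = _ := by
        rw [Matrix.trace_mul_comm, hk, Matrix.mul_assoc _ kᵀ, hk]; simp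
  rw [norm_eq, norm_eq, ← Matrix.trace_sum, ← Matrix.trace_sum]
  simp only [Rm_mact h hk, Matrix.transpose_sum, Matrix.transpose_smul]
  rw [quad_sum hk, Matrix.trace_sum, Matrix.trace_sum]
  simp only [t, c]

lemma Ricac_mact {μ : Bil m} (h : IsSkewBil μ) {k : Matrix (Fin m) (Fin m) ℝ} (hk : kᵀ * k = 1)
    (J : Matrix (Fin m) (Fin m) ℝ) :
    Ricac (k * J * kᵀ) (mact k μ) = k * Ricac J μ * kᵀ := by
  rw [Ricac, Ricac, Ric_mact h hk]
  have : k * J * kᵀ * (k * RicM μ * kᵀ) * (k * J * kᵀ) = k * (J * RicM μ * J) * kᵀ := by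
    calc _ = k * J * (kᵀ * k) * RicM μ * (kᵀ * k) * J * kᵀ := by simp only [Matrix.mul_assoc]
      _ = _ := by rw [hk]; simp only [Matrix.mul_assoc, Matrix.one_mul]
  rw [this]
  simp only [Matrix.mul_add, Matrix.add_mul, Matrix.mul_smul, Matrix.smul_mul]

lemma Ric_symm (μ : Bil m) : (RicM μ)ᵀ = RicM μ := by
  ext x y
  simp only [RicM, Matrix.transpose_apply, Matrix.of_apply]
  congr 2 <;> refine Finset.sum_congr rfl fun i _ => Finset.sum_congr rfl fun j _ => ?_ <;> ring

lemma Ricac_symm {J : Matrix (Fin m) (Fin m) ℝ} (hJ : Jᵀ = -J) (μ : Bil m) :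
    (Ricac J μ)ᵀ = Ricac J μ := by
  simp [Ricac, Ric_symm, hJ, Matrix.mul_assoc]

lemma Ricac_anti {J : Matrix (Fin m) (Fin m) ℝ} (hJ : J * J = -1) (μ : Bil m) :
    Ricac J μ * J = -(J * Ricac J μ) := by
  have e1 : J * RicM μ * J * J = - (J * RicM μ) := by rw [Matrix.mul_assoc _ J J, hJ]; simp
  have e2 : J * (J * RicM μ * J) = - (RicM μ * J) := by
    rw [← Matrix.mul_assoc, ← Matrix.mul_assoc, hJ]; simp
  simp only [Ricac, Matrix.smul_mul, Matrix.mul_smul, Matrix.add_mul, Matrix.mul_add, e1, e2]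
  rw [← smul_neg]
  congr 1
  abel

lemma trace_Ricac {J B : Matrix (Fin m) (Fin m) ℝ} (hJ : J * J = -1) (hB : B * J = -(J * B))
    (μ : Bil m) : Matrix.trace (Ricac J μ * B) = Matrix.trace (RicM μ * B) := by
  have e : Matrix.trace (J * RicM μ * J * B) = Matrix.trace (RicM μ * B) := by
    rw [Matrix.mul_assoc, Matrix.mul_assoc, Matrix.trace_mul_comm, Matrix.mul_assoc, Matrix.mul_assoc,
      hB, Matrix.mul_neg, ← Matrix.mul_assoc J J, hJ]
    simp
  rw [Ricac, Matrix.smul_mul, Matrix.trace_smul, Matrix.add_mul, Matrix.trace_add, e, smul_eq_mul]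
  ring

lemma trace_diag {μ : Bil m} (h : IsSkewBil μ) (Λ : Fin m → ℝ) :
    4 * Matrix.trace (RicM μ * Matrix.diagonal Λ) =
      ∑ a, ∑ b, ∑ c, (Λ c - Λ a - Λ b) * (μ (bvec m a) (bvec m b) c) ^ 2 := by
  have s : ∀ a b c, (μ (bvec m a) (bvec m b) c) ^ 2 = (μ (bvec m b) (bvec m a) c) ^ 2 := by
    intro a b c
    rw [h.2.2 (bvec m a)]
    simp
  have e1 : ∑ a, ∑ b, ∑ c, Λ b * (μ (bvec m a) (bvec m b) c) ^ 2
      = ∑ a, ∑ b, ∑ c, Λ a * (μ (bvec m a) (bvec m b) c) ^ 2 := by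
    rw [Finset.sum_comm]
    refine Finset.sum_congr rfl fun i _ => Finset.sum_congr rfl fun j _ =>
      Finset.sum_congr rfl fun k _ => ?_
    rw [s]
  have e2 : ∑ a, ∑ b, ∑ c, Λ c * (μ (bvec m a) (bvec m b) c) ^ 2
      = ∑ c, ∑ a, ∑ b, Λ c * (μ (bvec m a) (bvec m b) c) ^ 2 := by
    rw [Finset.sum_comm' (t' := Finset.univ) (s' := fun _ => Finset.univ) (by simp)]
    rw [Finset.sum_comm]
    conv_rhs => rw [Finset.sum_comm]
    refine Finset.sum_congr rfl fun i _ => ?_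
    rw [Finset.sum_comm]
  simp only [sub_mul, Finset.sum_sub_distrib]
  rw [e1, e2]
  simp only [Matrix.trace, Matrix.diag_apply, Matrix.mul_diagonal, RicM, Matrix.of_apply]
  rw [← Finset.sum_sub_distrib, ← Finset.sum_sub_distrib, Finset.mul_sum]
  refine Finset.sum_congr rfl fun a _ => ?_
  simp only [← Finset.mul_sum, ← pow_two]
  ring

lemma norm_nonneg' (μ : Bil m) : 0 ≤ normSqV μ := by
  unfold normSqV; positivity

lemma norm_pos {μ : Bil m} (h : IsSkewBil μ) (h0 : μ ≠ 0) : 0 < normSqV μ := by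
  refine lt_of_le_of_ne (norm_nonneg' μ) fun h1 => h0 ?_
  have z : IsSkewBil (0 : Bil m) :=
    ⟨fun Y => ⟨by simp, by simp⟩, fun Y => ⟨by simp, by simp⟩, by simp⟩
  refine ext_bvec h z fun i j k => ?_
  have h2 := h1.symm
  unfold normSqV at h2
  rw [Finset.sum_eq_zero_iff_of_nonneg (fun _ _ => by positivity)] at h2
  have h3 := h2 i (Finset.mem_univ _)
  rw [Finset.sum_eq_zero_iff_of_nonneg (fun _ _ => by positivity)] at h3
  have h4 := h3 j (Finset.mem_univ _)
  rw [Finset.sum_eq_zero_iff_of_nonneg (fun _ _ => by positivity)] at h4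
  simpa using h4 k (Finset.mem_univ _)

lemma mact_ne_zero {μ : Bil m} (h0 : μ ≠ 0) {g : Matrix (Fin m) (Fin m) ℝ} (hg : IsUnit g) :
    mact g μ ≠ 0 := by
  intro h
  apply h0
  have h1 : mact g⁻¹ (mact g μ) = μ := by
    rw [← mact_mul, Matrix.nonsing_inv_mul _ ((Matrix.isUnit_iff_isUnit_det g).1 hg), mact_one]
  rw [← h1, h]
  funext X Y
  simp [mact]

lemma trace_cs {A B : Matrix (Fin m) (Fin m) ℝ} (hA : Aᵀ = A) (hB : Bᵀ = B) :
    (Matrix.trace (A * B)) ^ 2 ≤ Matrix.trace (A * A) * Matrix.trace (B * B) := by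
  have e : ∀ A B : Matrix (Fin m) (Fin m) ℝ, Bᵀ = B →
      Matrix.trace (A * B) = ∑ p : Fin m × Fin m, A p.1 p.2 * B p.1 p.2 := by
    intro A B hB
    rw [Fintype.sum_prod_type]
    simp only [Matrix.trace, Matrix.diag_apply, Matrix.mul_apply]
    refine Finset.sum_congr rfl fun i _ => Finset.sum_congr rfl fun j _ => ?_
    have := congrFun (congrFun hB i) j
    rw [Matrix.transpose_apply] at this
    rw [this]
  rw [e A B hB, e A A hA, e B B hB]
  simpa only [pow_two] using Finset.sum_mul_sq_le_sq_mul_sq Finset.univ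
    (fun p : Fin m × Fin m => A p.1 p.2) (fun p => B p.1 p.2)

lemma trace_sq_nonneg {A : Matrix (Fin m) (Fin m) ℝ} (hA : Aᵀ = A) :
    0 ≤ Matrix.trace (A * A) := by
  nth_rewrite 1 [← hA]
  simp only [Matrix.trace, Matrix.diag_apply, Matrix.mul_apply, Matrix.transpose_apply]
  exact Finset.sum_nonneg fun i _ => Finset.sum_nonneg fun j _ => mul_self_nonneg _

lemma core_min {J : Matrix (Fin m) (Fin m) ℝ} (hJ : J * J = -1) (hJs : Jᵀ = -J) {μ ν : Bil m}
    (hμ : IsSkewBil μ) (hν : IsSkewBil ν) (h0 : μ ≠ 0) (h1 : ν ≠ 0) {Λ : Fin m → ℝ} {s : ℝ}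
    (hR : Ricac J μ = Matrix.diagonal Λ)
    (hx : ∀ a b c, (Λ c - Λ a - Λ b) * μ (bvec m a) (bvec m b) c = s * μ (bvec m a) (bvec m b) c)
    (hy : ∀ a b c, ν (bvec m a) (bvec m b) c ≠ 0 → s ≤ Λ c - Λ a - Λ b) :
    Matrix.trace (Ricac J μ * Ricac J μ) / (normSqV μ) ^ 2
      ≤ Matrix.trace (Ricac J ν * Ricac J ν) / (normSqV ν) ^ 2 := by
  have p0 := norm_pos hμ h0
  have p1 := norm_pos hν h1
  have anti : Matrix.diagonal Λ * J = -(J * Matrix.diagonal Λ) := by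
    rw [← hR]; exact Ricac_anti hJ μ
  have sym : (Matrix.diagonal Λ)ᵀ = Matrix.diagonal Λ := Matrix.diagonal_transpose _
  have e0 : 4 * Matrix.trace (Ricac J μ * Ricac J μ) = s * normSqV μ := by
    have : Matrix.trace (Ricac J μ * Ricac J μ) = Matrix.trace (RicM μ * Matrix.diagonal Λ) := by
      rw [← trace_Ricac hJ anti, hR]
    rw [this, trace_diag hμ]
    simp only [normSqV, Finset.mul_sum]
    refine Finset.sum_congr rfl fun a _ => Finset.sum_congr rfl fun b _ =>
      Finset.sum_congr rfl fun c _ => ?_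
    rw [pow_two, ← mul_assoc, hx, mul_assoc]
  have e1 : s * normSqV ν ≤ 4 * Matrix.trace (Ricac J ν * Matrix.diagonal Λ) := by
    rw [trace_Ricac hJ anti, trace_diag hν]
    simp only [normSqV, Finset.mul_sum]
    refine Finset.sum_le_sum fun a _ => Finset.sum_le_sum fun b _ =>
      Finset.sum_le_sum fun c _ => ?_
    by_cases hz : ν (bvec m a) (bvec m b) c = 0
    · simp [hz]
    · exact mul_le_mul_of_nonneg_right (hy a b c hz) (sq_nonneg _)
  have cs := trace_cs (Ricac_symm hJs ν) sym
  rw [← hR] at e1 cs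
  set A := Matrix.trace (Ricac J μ * Ricac J μ)
  set B := Matrix.trace (Ricac J ν * Ricac J ν)
  set T := Matrix.trace (Ricac J ν * Ricac J μ)
  set N := normSqV μ
  set M := normSqV ν
  have hA : 0 ≤ A := trace_sq_nonneg (Ricac_symm hJs μ)
  have hB : 0 ≤ B := trace_sq_nonneg (Ricac_symm hJs ν)
  rcases hA.eq_or_lt with hA0 | hA0
  · rw [← hA0]
    simp only [zero_div]
    positivity
  rw [div_le_div_iff₀ (by positivity) (by positivity)]
  have hs : 0 < s := by
    by_contra hs
    push Not at hs
    nlinarith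
  have h2 : (s * M) ^ 2 ≤ (4 * T) ^ 2 := pow_le_pow_left₀ (by positivity) e1 2
  have h3 : (s * M) ^ 2 * N ^ 2 ≤ 16 * (B * A) * N ^ 2 := by
    apply mul_le_mul_of_nonneg_right _ (by positivity)
    linarith [h2, cs]
  have h4 : (s * M) ^ 2 * N ^ 2 = 16 * A ^ 2 * M ^ 2 := by
    have : (s * M) ^ 2 * N ^ 2 = (s * N) ^ 2 * M ^ 2 := by ring
    rw [this, ← e0]; ring
  have h5 : A * (A * M ^ 2) ≤ A * (B * N ^ 2) := by nlinarith
  exact le_of_mul_le_mul_left h5 hA0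

lemma mact_diag_coord {μ : Bil m} (h : IsSkewBil μ) (Λ : Fin m → ℝ) (t : ℝ) (a b c : Fin m) :
    mact (Matrix.diagonal fun i => Real.exp (t * Λ i)) μ (bvec m a) (bvec m b) c =
      Real.exp (t * (Λ c - Λ a - Λ b)) * μ (bvec m a) (bvec m b) c := by
  have hi : (Matrix.diagonal fun i => Real.exp (t * Λ i))⁻¹ =
      Matrix.diagonal fun i => Real.exp (-(t * Λ i)) := by
    apply Matrix.inv_eq_left_inv
    rw [Matrix.diagonal_mul_diagonal]
    simp [← Real.exp_add]
  rw [mact_coord h, hi]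
  rw [Finset.sum_eq_single a (fun i _ hi => by simp [Matrix.diagonal_apply_ne _ hi]) (by simp),
    Finset.sum_eq_single b (fun i _ hi => by simp [Matrix.diagonal_apply_ne _ hi]) (by simp),
    Finset.sum_eq_single c (fun i _ hi => by simp [Matrix.diagonal_apply_ne _ hi.symm]) (by simp)]
  simp only [Matrix.diagonal_apply_eq]
  rw [← Real.exp_add, ← Real.exp_add]
  ring_nf

lemma core_crit {J : Matrix (Fin m) (Fin m) ℝ} (hJ : J * J = -1) {μ : Bil m}
    (hμ : IsSkewBil μ) (h0 : μ ≠ 0) {Λ : Fin m → ℝ}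
    (hR : Ricac J μ = Matrix.diagonal Λ)
    (hmin : ∀ t : ℝ, Matrix.trace (Ricac J μ * Ricac J μ) / (normSqV μ) ^ 2 ≤
      Matrix.trace (Ricac J (mact (Matrix.diagonal fun i => Real.exp (t * Λ i)) μ) *
        Ricac J (mact (Matrix.diagonal fun i => Real.exp (t * Λ i)) μ)) /
          (normSqV (mact (Matrix.diagonal fun i => Real.exp (t * Λ i)) μ)) ^ 2) :
    ∃ s : ℝ, ∀ a b c,
      (Λ c - Λ a - Λ b) * μ (bvec m a) (bvec m b) c = s * μ (bvec m a) (bvec m b) c := by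
  set ν : ℝ → Bil m := fun t => mact (Matrix.diagonal fun i => Real.exp (t * Λ i)) μ with hνdef
  have hc : ∀ t a b c, ν t (bvec m a) (bvec m b) c =
      Real.exp (t * (Λ c - Λ a - Λ b)) * μ (bvec m a) (bvec m b) c :=
    fun t a b c => mact_diag_coord hμ Λ t a b c
  have hν0 : ν 0 = μ := by
    simp only [hνdef, zero_mul, Real.exp_zero]
    rw [Matrix.diagonal_one, mact_one]
  have hνs : ∀ t, IsSkewBil (ν t) := fun t => skew_mact hμ _
  have hNpos : ∀ t, 0 < normSqV (ν t) := by
    intro t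
    refine norm_pos (hνs t) (mact_ne_zero h0 ?_)
    rw [Matrix.isUnit_iff_isUnit_det, Matrix.det_diagonal, isUnit_iff_ne_zero]
    exact Finset.prod_ne_zero_iff.2 fun i _ => (Real.exp_pos _).ne'
  have anti : Matrix.diagonal Λ * J = -(J * Matrix.diagonal Λ) := by
    rw [← hR]; exact Ricac_anti hJ μ
  have hRd : ∀ i j, Differentiable ℝ fun t => RicM (ν t) i j := by
    intro i j
    simp only [RicM, Matrix.of_apply, hc]
    fun_prop
  have hRacd : ∀ i j, Differentiable ℝ fun t => Ricac J (ν t) i j := by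
    intro i j
    simp only [Ricac, Matrix.smul_apply, Matrix.add_apply, Matrix.mul_apply, smul_eq_mul]
    fun_prop
  have hR' : ∀ i j, HasDerivAt (fun t => Ricac J (ν t) i j)
      (deriv (fun t => Ricac J (ν t) i j) 0) 0 := fun i j => (hRacd i j 0).hasDerivAt
  set R' : Fin m → Fin m → ℝ := fun i j => deriv (fun t => Ricac J (ν t) i j) 0
  set w : Fin m → Fin m → Fin m → ℝ := fun a b c => Λ c - Λ a - Λ b with hw
  set x : Fin m → Fin m → Fin m → ℝ := fun a b c => μ (bvec m a) (bvec m b) c with hx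
  set P := ∑ a, ∑ b, ∑ c, w a b c * x a b c ^ 2 with hP
  set Q := ∑ a, ∑ b, ∑ c, w a b c ^ 2 * x a b c ^ 2 with hQ
  have dexp : ∀ r : ℝ, HasDerivAt (fun t : ℝ => Real.exp (t * r) ^ 2) (2 * r) 0 := by
    intro r
    have h1 : HasDerivAt (fun t : ℝ => t * r) r 0 := by simpa using (hasDerivAt_id (0:ℝ)).mul_const r
    have := (h1.exp).fun_pow 2
    simpa using this
  have d1 : HasDerivAt (fun t => 4 * Matrix.trace (RicM (ν t) * Matrix.diagonal Λ)) (2 * Q) 0 := by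
    simp only [trace_diag (hνs _), hc, mul_pow]
    rw [hQ]
    simp only [Finset.mul_sum]
    refine HasDerivAt.fun_sum fun a _ => HasDerivAt.fun_sum fun b _ => HasDerivAt.fun_sum fun c _ => ?_
    have := ((dexp (w a b c)).mul_const (x a b c ^ 2)).const_mul (w a b c)
    exact this.congr_deriv (by ring)
  have d1' : HasDerivAt (fun t => 4 * Matrix.trace (RicM (ν t) * Matrix.diagonal Λ))
      (4 * ∑ i, R' i i * Λ i) 0 := by
    simp only [← trace_Ricac hJ anti]
    simp only [Matrix.trace, Matrix.diag_apply, Matrix.mul_diagonal]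
    exact (HasDerivAt.fun_sum fun i _ => (hR' i i).mul_const (Λ i)).const_mul 4
  have q1 : 4 * ∑ i, R' i i * Λ i = 2 * Q := d1'.unique d1
  have d2 : HasDerivAt (fun t => Matrix.trace (Ricac J (ν t) * Ricac J (ν t))) Q 0 := by
    have : HasDerivAt (fun t => Matrix.trace (Ricac J (ν t) * Ricac J (ν t)))
        (∑ i, ∑ j, (R' i j * Ricac J (ν 0) j i + Ricac J (ν 0) i j * R' j i)) 0 := by
      simp only [Matrix.trace, Matrix.diag_apply, Matrix.mul_apply]
      exact HasDerivAt.fun_sum fun i _ => HasDerivAt.fun_sum fun j _ => (hR' i j).mul (hR' j i)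
    convert this using 1
    rw [hν0, hR]
    simp only [Matrix.diagonal_apply, mul_ite, ite_mul, mul_zero, zero_mul, Finset.sum_add_distrib,
      Finset.sum_ite_eq, Finset.sum_ite_eq', Finset.mem_univ, if_true]
    have : ∑ i, Λ i * R' i i = ∑ i, R' i i * Λ i := Finset.sum_congr rfl fun i _ => mul_comm _ _
    rw [this]
    linarith
  have d3 : HasDerivAt (fun t => normSqV (ν t)) (2 * P) 0 := by
    simp only [normSqV, hc, mul_pow]
    rw [hP]
    simp only [Finset.mul_sum]
    refine HasDerivAt.fun_sum fun a _ => HasDerivAt.fun_sum fun b _ => HasDerivAt.fun_sum fun c _ => ?_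
    exact ((dexp (w a b c)).mul_const (x a b c ^ 2)).congr_deriv (by ring)
  set f0 := Matrix.trace (Ricac J μ * Ricac J μ) with hf0
  set N := normSqV μ with hN
  have hNp : 0 < N := norm_pos hμ h0
  have q2 : 4 * f0 = P := by
    rw [hf0, hP, ← trace_diag hμ, ← trace_Ricac hJ anti, hR]
  have d4 := (d2.mul_const (N ^ 2)).sub ((d3.fun_pow 2).const_mul f0)
  have loc : IsLocalMin (fun t => Matrix.trace (Ricac J (ν t) * Ricac J (ν t)) * N ^ 2 -
      f0 * (normSqV (ν t)) ^ 2) 0 := by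
    refine Filter.Eventually.of_forall fun t => ?_
    have := hmin t
    rw [div_le_div_iff₀ (by positivity) (by have := hNpos t; positivity)] at this
    simp only [hν0]
    rw [← hf0, ← hN]
    linarith
  have q3 := loc.hasDerivAt_eq_zero d4
  simp only [hν0] at q3
  rw [← hN] at q3
  have q4 : Q * N = P ^ 2 := by
    have : N * (Q * N - P ^ 2) = 0 := by
      rw [← q3, ← q2]
      push_cast
      ring
    rcases mul_eq_zero.1 this with h | h
    · exact absurd h hNp.ne'
    · linarith
  refine ⟨P / N, ?_⟩
  have q5 : ∑ a, ∑ b, ∑ c, (w a b c - P / N) ^ 2 * x a b c ^ 2 = 0 := by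
    have : ∀ s : ℝ, ∑ a, ∑ b, ∑ c, (w a b c - s) ^ 2 * x a b c ^ 2 =
        Q - 2 * s * P + s ^ 2 * N := by
      intro s
      rw [hQ, hN, normSqV, hP]
      simp only [Finset.mul_sum, ← Finset.sum_sub_distrib, ← Finset.sum_add_distrib]
      refine Finset.sum_congr rfl fun a _ => Finset.sum_congr rfl fun b _ =>
        Finset.sum_congr rfl fun c _ => ?_
      ring
    rw [this]
    field_simp
    linarith
  intro a b c
  rw [Finset.sum_eq_zero_iff_of_nonneg (fun _ _ => by positivity)] at q5
  have h3 := q5 a (Finset.mem_univ _)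
  rw [Finset.sum_eq_zero_iff_of_nonneg (fun _ _ => by positivity)] at h3
  have h4 := h3 b (Finset.mem_univ _)
  rw [Finset.sum_eq_zero_iff_of_nonneg (fun _ _ => by positivity)] at h4
  have h5 := h4 c (Finset.mem_univ _)
  rw [← mul_pow] at h5
  have h6 := pow_eq_zero_iff (two_ne_zero) |>.1 h5
  have : w a b c * x a b c = P / N * x a b c := by linarith
  exact this

lemma exists_eigen {B : Matrix (Fin m) (Fin m) ℝ} (hB : Bᵀ = B) {ι : Type} [Fintype ι]
    (v : ι → Vec m) (c : ι → ℝ) (hv : ∀ i, B *ᵥ v i = c i • v i) (hcard : Fintype.card ι < m) :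
    ∃ (u : Vec m) (r : ℝ), u ⬝ᵥ u = 1 ∧ B *ᵥ u = r • u ∧ ∀ i, u ⬝ᵥ v i = 0 := by
  set T := Matrix.toEuclideanLin B with hT
  have hsym : T.IsSymmetric := by
    rw [hT, Matrix.isSymmetric_toEuclideanLin_iff]
    rw [Matrix.IsHermitian, Matrix.conjTranspose_eq_transpose_of_trivial, hB]
  set v' : ι → EuclideanSpace ℝ (Fin m) := fun i => WithLp.toLp 2 (v i) with hv'
  have hTv : ∀ i, T (v' i) = c i • v' i := by
    intro i
    rw [hT, hv', Matrix.toEuclideanLin_toLp, ← WithLp.toLp_smul, ← hv i]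
    rfl
  set S := Submodule.span ℝ (Set.range v') with hS
  have hinv : ∀ x ∈ Sᗮ, T x ∈ Sᗮ := by
    intro x hx
    rw [Submodule.mem_orthogonal]
    intro y hy
    rw [← hsym]
    refine Submodule.inner_right_of_mem_orthogonal ?_ hx
    induction hy using Submodule.span_induction with
    | mem y hy =>
      obtain ⟨i, rfl⟩ := hy
      rw [hTv]
      exact S.smul_mem _ (Submodule.subset_span ⟨i, rfl⟩)
    | zero => simp
    | add a b _ _ ha hb => rw [map_add]; exact S.add_mem ha hb
    | smul r a _ ha => rw [map_smul]; exact S.smul_mem _ ha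
  have hdim : 0 < Module.finrank ℝ Sᗮ := by
    have h1 := Submodule.finrank_add_finrank_orthogonal S
    have h2 : Module.finrank ℝ S ≤ Fintype.card ι := finrank_range_le_card v'
    rw [finrank_euclideanSpace, Fintype.card_fin] at h1
    omega
  have : Nontrivial Sᗮ := Module.finrank_pos_iff.1 hdim
  have hsym' := hsym.restrict_invariant hinv
  obtain ⟨x, hx⟩ := (hsym'.hasEigenvalue_iSup_of_finiteDimensional).exists_hasEigenvector
  set r : ℝ := (⨆ x : { x : Sᗮ // x ≠ 0 }, RCLike.re (inner ℝ ((T.restrict hinv) x) (x : Sᗮ)) / ‖(x : Sᗮ)‖ ^ 2 : ℝ)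
  have hx1 : T (x : EuclideanSpace ℝ (Fin m)) = r • (x : EuclideanSpace ℝ (Fin m)) := by
    have := congrArg Subtype.val hx.apply_eq_smul
    simpa using this
  have hx0 : (x : EuclideanSpace ℝ (Fin m)) ≠ 0 := by
    have := hx.2
    simpa using this
  set y : EuclideanSpace ℝ (Fin m) := (x : EuclideanSpace ℝ (Fin m)) with hy
  have hn : ‖y‖ ≠ 0 := by simpa using hx0
  have hyy : WithLp.ofLp y ⬝ᵥ WithLp.ofLp y = ‖y‖ ^ 2 := by
    rw [← real_inner_self_eq_norm_sq, EuclideanSpace.inner_eq_star_dotProduct]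
    simp
  refine ⟨(‖y‖⁻¹) • WithLp.ofLp y, r, ?_, ?_, ?_⟩
  · rw [smul_dotProduct, dotProduct_smul, hyy, smul_eq_mul, smul_eq_mul]
    field_simp
  · have h3 : B *ᵥ WithLp.ofLp y = r • WithLp.ofLp y := by
      have := congrArg WithLp.ofLp hx1
      rw [hT, Matrix.ofLp_toEuclideanLin_apply] at this
      simpa using this
    rw [Matrix.mulVec_smul, h3, smul_comm]
  · intro i
    have hmem : v' i ∈ S := Submodule.subset_span ⟨i, rfl⟩
    have h4 : inner ℝ (v' i) y = 0 := Submodule.inner_right_of_mem_orthogonal hmem x.2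
    rw [EuclideanSpace.inner_eq_star_dotProduct] at h4
    rw [smul_dotProduct]
    have : WithLp.ofLp y ⬝ᵥ v i = 0 := by simpa [hv'] using h4
    rw [this, smul_zero]

/-- orthonormal family spanning an isotropic subspace. -/
def IsFrame (J : Matrix (Fin m) (Fin m) ℝ) {k : ℕ} (e : Fin k → Vec m) : Prop :=
  (∀ i j, e i ⬝ᵥ e j = if i = j then 1 else 0) ∧ ∀ i j, e i ⬝ᵥ J *ᵥ e j = 0

lemma dot_J {J : Matrix (Fin m) (Fin m) ℝ} (hJ : Jᵀ = -J) (X Y : Vec m) :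
    (J *ᵥ X) ⬝ᵥ Y = -(X ⬝ᵥ J *ᵥ Y) := by
  rw [Matrix.dotProduct_mulVec, ← Matrix.mulVec_transpose, hJ, Matrix.neg_mulVec, neg_dotProduct,
    neg_neg]

lemma dot_JJ {J : Matrix (Fin m) (Fin m) ℝ} (hJ : Jᵀ = -J) (hJ2 : J * J = -1) (X Y : Vec m) :
    (J *ᵥ X) ⬝ᵥ (J *ᵥ Y) = X ⬝ᵥ Y := by
  rw [dot_J hJ, Matrix.mulVec_mulVec, hJ2, Matrix.neg_mulVec, Matrix.one_mulVec, dotProduct_neg,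
    neg_neg]

lemma dot_J_self {J : Matrix (Fin m) (Fin m) ℝ} (hJ : Jᵀ = -J) (X : Vec m) :
    X ⬝ᵥ J *ᵥ X = 0 := by
  have := dot_J hJ X X
  rw [dotProduct_comm] at this
  linarith

lemma frame_step {J B : Matrix (Fin m) (Fin m) ℝ} (hJ : Jᵀ = -J) (hJ2 : J * J = -1)
    (hB : Bᵀ = B) (hBJ : B * J = -(J * B)) {k : ℕ} (hk : 2 * k < m) {e : Fin k → Vec m}
    {l : Fin k → ℝ} (he : IsFrame J e) (hl : ∀ i, 0 ≤ l i) (hBe : ∀ i, B *ᵥ e i = l i • e i) :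
    ∃ (e : Fin (k + 1) → Vec m) (l : Fin (k + 1) → ℝ), IsFrame J e ∧ (∀ i, 0 ≤ l i) ∧
      ∀ i, B *ᵥ e i = l i • e i := by
  have anti : ∀ (X : Vec m) (r : ℝ), B *ᵥ X = r • X → B *ᵥ (J *ᵥ X) = (-r) • (J *ᵥ X) := by
    intro X r h
    rw [Matrix.mulVec_mulVec, hBJ, Matrix.neg_mulVec, ← Matrix.mulVec_mulVec, h, Matrix.mulVec_smul,
      neg_smul]
  obtain ⟨u, r, hu1, hu2, hu3⟩ := exists_eigen hB (ι := Fin k ⊕ Fin k)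
    (Sum.elim e fun i => J *ᵥ e i) (Sum.elim l fun i => - l i)
    (by rintro (i | i); exacts [hBe i, anti _ _ (hBe i)]) (by simp; omega)
  have hua : ∀ i, u ⬝ᵥ e i = 0 := fun i => hu3 (Sum.inl i)
  have hub : ∀ i, u ⬝ᵥ J *ᵥ e i = 0 := fun i => hu3 (Sum.inr i)
  have key : ∃ (u : Vec m) (r : ℝ), 0 ≤ r ∧ u ⬝ᵥ u = 1 ∧ B *ᵥ u = r • u ∧ (∀ i, u ⬝ᵥ e i = 0) ∧
      ∀ i, u ⬝ᵥ J *ᵥ e i = 0 := by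
    rcases le_total 0 r with h | h
    · exact ⟨u, r, h, hu1, hu2, hua, hub⟩
    · refine ⟨J *ᵥ u, -r, by linarith, by rw [dot_JJ hJ hJ2, hu1], anti _ _ hu2, fun i => ?_,
        fun i => ?_⟩
      · rw [dot_J hJ, hub, neg_zero]
      · rw [dot_JJ hJ hJ2, hua]
  obtain ⟨u, r, hr, h1, h2, h3, h4⟩ := key
  have h5 : ∀ i, e i ⬝ᵥ J *ᵥ u = 0 := by
    intro i
    have := dot_J hJ (e i) u
    rw [dotProduct_comm, h4] at this
    linarith
  refine ⟨Fin.cons u e, Fin.cons r l, ⟨fun i j => ?_, fun i j => ?_⟩, fun i => ?_, fun i => ?_⟩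
  · refine Fin.cases ?_ (fun i => ?_) i <;> refine Fin.cases ?_ (fun j => ?_) j
    · simp [h1]
    · simp [h3, (Fin.succ_ne_zero _).symm]
    · simp [dotProduct_comm (e i), h3]
    · simp [he.1]
  · refine Fin.cases ?_ (fun i => ?_) i <;> refine Fin.cases ?_ (fun j => ?_) j
    · simp [dot_J_self hJ]
    · simp [h4]
    · simp [h5]
    · simp [he.2]
  · refine Fin.cases ?_ (fun i => ?_) i
    · simpa using hr
    · simpa using hl i
  · refine Fin.cases ?_ (fun i => ?_) i
    · simpa using h2
    · simpa using hBe i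

lemma exists_frame (n : ℕ) {J B : Matrix (Fin (2 * n)) (Fin (2 * n)) ℝ} (hJ : Jᵀ = -J)
    (hJ2 : J * J = -1) (hB : Bᵀ = B) (hBJ : B * J = -(J * B)) :
    ∃ (e : Fin n → Vec (2 * n)) (l : Fin n → ℝ), IsFrame J e ∧ (∀ i, 0 ≤ l i) ∧
      Antitone l ∧ ∀ i, B *ᵥ e i = l i • e i := by
  have H : ∀ k ≤ n, ∃ (e : Fin k → Vec (2 * n)) (l : Fin k → ℝ), IsFrame J e ∧ (∀ i, 0 ≤ l i) ∧
      ∀ i, B *ᵥ e i = l i • e i := by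
    intro k
    induction k with
    | zero =>
      intro _
      exact ⟨Fin.elim0, Fin.elim0, ⟨fun i => i.elim0, fun i => i.elim0⟩, fun i => i.elim0,
        fun i => i.elim0⟩
    | succ k ih =>
      intro hk
      obtain ⟨e, l, h1, h2, h3⟩ := ih (by omega)
      exact frame_step hJ hJ2 hB hBJ (by omega) h1 h2 h3
  obtain ⟨e, l, h1, h2, h3⟩ := H n le_rfl
  set σ := Tuple.sort fun i => - l i with hσ
  have hm : Monotone ((fun i => - l i) ∘ σ) := Tuple.monotone_sort _
  refine ⟨e ∘ σ, l ∘ σ, ⟨fun i j => ?_, fun i j => h1.2 _ _⟩, fun i => h2 _, fun i j hij => ?_,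
    fun i => h3 _⟩
  · simp [h1.1]
  · have := hm hij
    simp only [Function.comp] at this ⊢
    linarith

/-- Gram-Schmidt for the dot product. -/
lemma gs {n : ℕ} (v : Fin n → Vec m) (hv : LinearIndependent ℝ v) :
    ∃ f : Fin n → Vec m, (∀ i j, f i ⬝ᵥ f j = if i = j then 1 else 0) ∧
      (∀ i, f i ∈ Submodule.span ℝ (v '' Set.Iic i)) ∧ ∀ i j, i < j → f j ⬝ᵥ v i = 0 := by
  set L := (WithLp.linearEquiv 2 ℝ (Fin m → ℝ)) with hL
  set v' : Fin n → EuclideanSpace ℝ (Fin m) := fun i => WithLp.toLp 2 (v i) with hv'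
  have hli : LinearIndependent ℝ v' := by
    have := hv.map' L.symm.toLinearMap (LinearMap.ker_eq_bot.2 L.symm.injective)
    exact this
  have ho := InnerProductSpace.gramSchmidtNormed_orthonormal hli
  set f' := InnerProductSpace.gramSchmidtNormed ℝ v' with hf'
  have hd : ∀ x y : EuclideanSpace ℝ (Fin m), WithLp.ofLp x ⬝ᵥ WithLp.ofLp y = inner ℝ x y := by
    intro x y
    rw [real_inner_comm, EuclideanSpace.inner_eq_star_dotProduct]
    simp
  refine ⟨fun i => WithLp.ofLp (f' i), fun i j => ?_, fun i => ?_, fun i j hij => ?_⟩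
  · rw [hd]
    exact orthonormal_iff_ite.1 ho i j
  · have h1 : f' i ∈ Submodule.span ℝ (v' '' Set.Iic i) := by
      rw [← InnerProductSpace.span_gramSchmidt_Iic ℝ v' i, ← InnerProductSpace.span_gramSchmidtNormed]
      exact Submodule.subset_span ⟨i, Set.self_mem_Iic, rfl⟩
    have h2 := Submodule.mem_map_of_mem (f := L.toLinearMap) h1
    rw [Submodule.map_span, ← Set.image_comp] at h2
    exact h2
  · have : (v i) = WithLp.ofLp (v' i) := rfl
    rw [this, hd, hf', InnerProductSpace.gramSchmidtNormed, inner_smul_left,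
      InnerProductSpace.gramSchmidt_inv_triangular ℝ v' hij, mul_zero]

/-- index bookkeeping: `2n = n + n`. -/
def eqv (n : ℕ) : Fin n ⊕ Fin n ≃ Fin (2 * n) := finSumFinEquiv.trans (finCongr (by omega))

/-- the vectors `e_i, J e_i`. -/
def vcol {n : ℕ} (J : Matrix (Fin m) (Fin m) ℝ) (e : Fin n → Vec m) : Fin n ⊕ Fin n → Vec m :=
  Sum.elim e fun i => J *ᵥ e i

/-- matrix with columns `e_i, J e_i`. -/
def fmat {n : ℕ} (J : Matrix (Fin (2 * n)) (Fin (2 * n)) ℝ) (e : Fin n → Vec (2 * n)) :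
    Matrix (Fin (2 * n)) (Fin (2 * n)) ℝ :=
  Matrix.of fun i a => vcol J e ((eqv n).symm a) i

/-- the eigenvalues `l_i, -l_i`. -/
def lam {n : ℕ} (l : Fin n → ℝ) : Fin (2 * n) → ℝ :=
  fun a => Sum.elim l (fun i => - l i) ((eqv n).symm a)

section frames

variable {n : ℕ} {J : Matrix (Fin (2 * n)) (Fin (2 * n)) ℝ} {e f : Fin n → Vec (2 * n)}

lemma fmat_entry (M : Matrix (Fin (2 * n)) (Fin (2 * n)) ℝ) (a b : Fin (2 * n)) :
    ((fmat J e)ᵀ * M * fmat J f) a b =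
      vcol J e ((eqv n).symm a) ⬝ᵥ M *ᵥ vcol J f ((eqv n).symm b) := by
  rw [Matrix.mul_assoc]
  simp only [Matrix.mul_apply, Matrix.transpose_apply, fmat, Matrix.of_apply, dotProduct,
    Matrix.mulVec]

lemma fmat_orth (hJ : Jᵀ = -J) (hJ2 : J * J = -1) (he : IsFrame J e) :
    (fmat J e)ᵀ * fmat J e = 1 := by
  have h : (fmat J e)ᵀ * fmat J e = (fmat J e)ᵀ * 1 * fmat J e := by rw [Matrix.mul_one]
  rw [h]
  ext a b
  rw [fmat_entry, Matrix.one_mulVec]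
  obtain ⟨a, rfl⟩ := (eqv n).surjective a
  obtain ⟨b, rfl⟩ := (eqv n).surjective b
  rw [Equiv.symm_apply_apply, Equiv.symm_apply_apply]
  rcases a with a | a <;> rcases b with b | b
  · simp [vcol, he.1, Matrix.one_apply]
  · simp [vcol, he.2, Matrix.one_apply]
  · simp [vcol, dot_J hJ, he.2, Matrix.one_apply]
  · simp [vcol, dot_JJ hJ hJ2, he.1, Matrix.one_apply]

lemma fmat_J (hJ : Jᵀ = -J) (hJ2 : J * J = -1) (he : IsFrame J e) (hf : IsFrame J f) :
    (fmat J e)ᵀ * J * fmat J e = (fmat J f)ᵀ * J * fmat J f := by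
  ext a b
  rw [fmat_entry, fmat_entry]
  rcases (eqv n).symm a with a | a <;> rcases (eqv n).symm b with b | b
  · simp [vcol, he.2, hf.2]
  · simp only [vcol, Sum.elim_inl, Sum.elim_inr, Matrix.mulVec_mulVec, hJ2]
    simp [Matrix.neg_mulVec, he.1, hf.1]
  · simp [vcol, dot_JJ hJ hJ2, he.1, hf.1]
  · simp only [vcol, Sum.elim_inr]
    rw [dot_JJ hJ hJ2, dot_JJ hJ hJ2, he.2, hf.2]

lemma fmat_diag {B : Matrix (Fin (2 * n)) (Fin (2 * n)) ℝ} (hJ : Jᵀ = -J) (hJ2 : J * J = -1)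
    (hBJ : B * J = -(J * B)) (he : IsFrame J e) {l : Fin n → ℝ}
    (hl : ∀ i, B *ᵥ e i = l i • e i) :
    (fmat J e)ᵀ * B * fmat J e = Matrix.diagonal (lam l) := by
  have hv : ∀ p, B *ᵥ vcol J e p = (Sum.elim l (fun i => - l i) p) • vcol J e p := by
    rintro (i | i)
    · exact hl i
    · simp only [vcol, Sum.elim_inr]
      rw [Matrix.mulVec_mulVec, hBJ, Matrix.neg_mulVec, ← Matrix.mulVec_mulVec, hl,
        Matrix.mulVec_smul, neg_smul]
  ext a b
  have h1 := congrFun (congrFun (fmat_orth hJ hJ2 he) a) b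
  have h2 := fmat_entry (J := J) (e := e) (f := e) 1 a b
  rw [Matrix.mul_one, h1, Matrix.one_mulVec] at h2
  rw [fmat_entry, hv, dotProduct_smul, ← h2, Matrix.diagonal_apply, Matrix.one_apply]
  by_cases hab : a = b
  · subst hab
    simp [lam]
  · simp [hab]

/-- the KP-decomposition of a symplectic matrix, adapted to a frame. -/
lemma exists_adapted (hJ : Jᵀ = -J) (hJ2 : J * J = -1) (he : IsFrame J e) {l : Fin n → ℝ}
    (hl0 : ∀ i, 0 ≤ l i) (hla : Antitone l)
    {g : Matrix (Fin (2 * n)) (Fin (2 * n)) ℝ} (hg : IsSymplMat J g) :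
    ∃ f : Fin n → Vec (2 * n), IsFrame J f ∧
      ∀ a b, ((fmat J f)ᵀ * g * fmat J e) a b ≠ 0 → lam l b ≤ lam l a := by
  have hdet := (Matrix.isUnit_iff_isUnit_det g).1 hg.1
  have gi : ∀ X, g⁻¹ *ᵥ (g *ᵥ X) = X := by
    intro X
    rw [Matrix.mulVec_mulVec, Matrix.nonsing_inv_mul _ hdet, Matrix.one_mulVec]
  have gi' : ∀ X, g *ᵥ (g⁻¹ *ᵥ X) = X := by
    intro X
    rw [Matrix.mulVec_mulVec, Matrix.mul_nonsing_inv _ hdet, Matrix.one_mulVec]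
  have hS : ∀ X Y, (g *ᵥ X) ⬝ᵥ J *ᵥ (g *ᵥ Y) = X ⬝ᵥ J *ᵥ Y := hg.2
  have hli : LinearIndependent ℝ fun i => g *ᵥ e i := by
    rw [Fintype.linearIndependent_iff]
    intro c hc j
    have h1 : g *ᵥ (∑ i, c i • e i) = 0 := by
      rw [Matrix.mulVec_sum, ← hc]
      exact Finset.sum_congr rfl fun i _ => Matrix.mulVec_smul _ _ _
    have h2 : ∑ i, c i • e i = 0 := by rw [← gi (∑ i, c i • e i), h1, Matrix.mulVec_zero]
    have h3 : e j ⬝ᵥ (∑ i, c i • e i) = c j := by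
      rw [dotProduct_sum]
      simp [dotProduct_smul, he.1]
    rw [← h3, h2, dotProduct_zero]
  obtain ⟨f, hf1, hf2, hf3⟩ := gs _ hli
  have key : ∀ i, ∀ x ∈ Submodule.span ℝ ((fun i => g *ᵥ e i) '' Set.Iic i),
      (∀ b, (J *ᵥ e b) ⬝ᵥ g⁻¹ *ᵥ x = 0) ∧ (∀ b, i < b → e b ⬝ᵥ g⁻¹ *ᵥ x = 0) ∧
        ∀ w, (∀ b, (J *ᵥ e b) ⬝ᵥ w = 0) → (g⁻¹ *ᵥ x) ⬝ᵥ J *ᵥ w = 0 := by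
    intro i x hx
    induction hx using Submodule.span_induction with
    | mem x hx =>
      obtain ⟨j, hj, rfl⟩ := hx
      refine ⟨fun b => ?_, fun b hb => ?_, fun w hw => ?_⟩
      · simp only [gi]
        rw [dot_J hJ, he.2, neg_zero]
      · simp only [gi]
        rw [he.1, if_neg]
        exact (lt_of_le_of_lt hj hb).ne'
      · simp only [gi]
        have := dot_J hJ (e j) w
        rw [hw] at this
        linarith
    | zero => simp
    | add x y _ _ hx hy =>
      refine ⟨fun b => ?_, fun b hb => ?_, fun w hw => ?_⟩
      · rw [Matrix.mulVec_add, dotProduct_add, hx.1, hy.1, add_zero]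
      · rw [Matrix.mulVec_add, dotProduct_add, hx.2.1 b hb, hy.2.1 b hb, add_zero]
      · rw [Matrix.mulVec_add, add_dotProduct, hx.2.2 w hw, hy.2.2 w hw, add_zero]
    | smul r x _ hx =>
      refine ⟨fun b => ?_, fun b hb => ?_, fun w hw => ?_⟩
      · rw [Matrix.mulVec_smul, dotProduct_smul, hx.1, smul_zero]
      · rw [Matrix.mulVec_smul, dotProduct_smul, hx.2.1 b hb, smul_zero]
      · rw [Matrix.mulVec_smul, smul_dotProduct, hx.2.2 w hw, smul_zero]
  have k1 : ∀ a b, (g⁻¹ *ᵥ f a) ⬝ᵥ J *ᵥ e b = 0 := by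
    intro a b
    rw [dotProduct_comm]
    exact (key a _ (hf2 a)).1 b
  refine ⟨f, ⟨hf1, fun i j => ?_⟩, fun a b hab => ?_⟩
  · rw [← gi' (f i), ← gi' (f j), hS]
    exact (key i _ (hf2 i)).2.2 _ (key j _ (hf2 j)).1
  · rw [fmat_entry] at hab
    simp only [lam]
    revert hab
    rcases (eqv n).symm a with a | a <;> rcases (eqv n).symm b with b | b <;>
      simp only [vcol, Sum.elim_inl, Sum.elim_inr] <;> intro hab
    · apply hla
      by_contra hlt
      push Not at hlt
      exact hab (hf3 b a hlt)
    · linarith [hl0 a, hl0 b]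
    · exfalso
      apply hab
      rw [dot_J hJ]
      nth_rewrite 1 [← gi' (f a)]
      rw [hS, k1, neg_zero]
    · apply neg_le_neg
      apply hla
      by_contra hlt
      push Not at hlt
      apply hab
      rw [dot_J hJ]
      nth_rewrite 1 [← gi' (f a)]
      rw [hS, Matrix.mulVec_mulVec, hJ2, Matrix.neg_mulVec, Matrix.one_mulVec, dotProduct_neg,
        dotProduct_comm, (key a _ (hf2 a)).2.1 b hlt]
      simp

end frames

lemma der_mact {μ : Bil m} {D g : Matrix (Fin m) (Fin m) ℝ} (hg : IsUnit g)
    (h : IsDerivation μ D) : IsDerivation (mact g μ) (g * D * g⁻¹) := by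
  have hdet := (Matrix.isUnit_iff_isUnit_det g).1 hg
  have gi : ∀ X, g⁻¹ *ᵥ (g *ᵥ X) = X := by
    intro X
    rw [Matrix.mulVec_mulVec, Matrix.nonsing_inv_mul _ hdet, Matrix.one_mulVec]
  intro X Y
  simp only [mact, ← Matrix.mulVec_mulVec, gi]
  rw [h, Matrix.mulVec_add]

lemma der_diag {μ : Bil m} (hμ : IsSkewBil μ) (d : Fin m → ℝ) :
    IsDerivation μ (Matrix.diagonal d) ↔
      ∀ a b c, (d c - d a - d b) * μ (bvec m a) (bvec m b) c = 0 := by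
  have hb : ∀ a, Matrix.diagonal d *ᵥ bvec m a = d a • bvec m a := by
    intro a
    ext i
    rw [Matrix.mulVec_diagonal]
    by_cases h : i = a
    · subst h; simp [bvec]
    · simp [bvec, h]
  constructor
  · intro h a b c
    have := congrFun (h (bvec m a) (bvec m b)) c
    rw [Matrix.mulVec_diagonal, hb, hb, (hμ.1 _).map_smul, (hμ.2.1 _).map_smul] at this
    simp only [Pi.add_apply, Pi.smul_apply, smul_eq_mul] at this
    linarith
  · intro h X Y
    ext c
    rw [Matrix.mulVec_diagonal, expand hμ X, expand hμ _ Y, expand hμ X (_ *ᵥ Y)]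
    simp only [Matrix.mulVec_diagonal, Pi.add_apply, Finset.sum_apply, Pi.smul_apply, smul_eq_mul,
      Finset.mul_sum, ← Finset.sum_add_distrib]
    refine Finset.sum_congr rfl fun i _ => Finset.sum_congr rfl fun j _ => ?_
    linear_combination X i * Y j * h i j c

lemma F_mact {μ : Bil m} (h : IsSkewBil μ) {k : Matrix (Fin m) (Fin m) ℝ} (hk : kᵀ * k = 1)
    (J : Matrix (Fin m) (Fin m) ℝ) :
    Matrix.trace (Ricac (k * J * kᵀ) (mact k μ) * Ricac (k * J * kᵀ) (mact k μ)) /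
        (normSqV (mact k μ)) ^ 2 =
      Matrix.trace (Ricac J μ * Ricac J μ) / (normSqV μ) ^ 2 := by
  rw [norm_mact h hk, Ricac_mact h hk]
  congr 1
  calc Matrix.trace (k * Ricac J μ * kᵀ * (k * Ricac J μ * kᵀ))
      = Matrix.trace (k * (Ricac J μ * (kᵀ * k) * Ricac J μ * kᵀ)) := by
        simp only [Matrix.mul_assoc]
    _ = _ := by
        rw [Matrix.trace_mul_comm, hk, Matrix.mul_assoc _ kᵀ, hk]; simp

end MinSymp

/-- a compatible metric on an (almost-)symplectic nilpotent Lie group is minimal iff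
`Ric^{ac} = cI + D` with `D` a derivation. -/
theorem minimal_iff_symplectic (n : ℕ) (hn : 1 ≤ n)
    (J : Matrix (Fin (2 * n)) (Fin (2 * n)) ℝ) (hJskew : Jᵀ = -J) (hJsq : J * J = -1)
    (μ : Bil (2 * n)) (hμ : NilBracket μ) (hμ0 : μ ≠ 0) :
    (∀ g : Matrix (Fin (2 * n)) (Fin (2 * n)) ℝ, IsSymplMat J g →
        Matrix.trace (Ricac J μ * Ricac J μ) / (normSqV μ) ^ 2
          ≤ Matrix.trace (Ricac J (mact g μ) * Ricac J (mact g μ)) / (normSqV (mact g μ)) ^ 2)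
      ↔ ∃ (c : ℝ) (D : Matrix (Fin (2 * n)) (Fin (2 * n)) ℝ),
          IsDerivation μ D ∧ Ricac J μ = c • (1 : Matrix (Fin (2 * n)) (Fin (2 * n)) ℝ) + D := by
  obtain ⟨hskew, -, -⟩ := hμ
  have hsym := MinSymp.Ricac_symm hJskew μ
  have hanti := MinSymp.Ricac_anti hJsq μ
  obtain ⟨e, l, he, hl0, hla, hle⟩ := MinSymp.exists_frame n hJskew hJsq hsym hanti
  have hU := MinSymp.fmat_orth hJskew hJsq he
  have hdiag := MinSymp.fmat_diag hJskew hJsq hanti he hle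
  have hJU := fun f hf => MinSymp.fmat_J (f := f) hJskew hJsq he hf
  have htri := fun g hg => MinSymp.exists_adapted (g := g) hJskew hJsq he hl0 hla hg
  have horth := fun f hf => MinSymp.fmat_orth (e := f) hJskew hJsq hf
  set U := MinSymp.fmat J e
  set Λ := MinSymp.lam l
  have hU' : U * Uᵀ = 1 := mul_eq_one_comm.1 hU
  have hUt : (Uᵀ)ᵀ * Uᵀ = 1 := by rw [Matrix.transpose_transpose, hU']
  have hUu : IsUnit U := IsUnit.of_mul_eq_one _ hU'
  have hUtu : IsUnit Uᵀ := IsUnit.of_mul_eq_one _ hU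
  have hUi : U⁻¹ = Uᵀ := Matrix.inv_eq_left_inv hU
  have hUti : (Uᵀ)⁻¹ = U := Matrix.inv_eq_left_inv hU'
  set J0 := Uᵀ * J * U with hJ0
  have hJ0sq : J0 * J0 = -1 := by
    calc J0 * J0 = Uᵀ * J * (U * Uᵀ) * J * U := by simp only [hJ0, Matrix.mul_assoc]
      _ = Uᵀ * (J * J) * U := by rw [hU']; simp only [Matrix.mul_assoc, Matrix.one_mul]
      _ = -1 := by rw [hJsq]; simp [hU]
  have hJ0s : J0ᵀ = -J0 := by
    simp [hJ0, Matrix.transpose_mul, hJskew, Matrix.mul_assoc]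
  set μ' := mact Uᵀ μ with hμ'
  have hskew' : IsSkewBil μ' := MinSymp.skew_mact hskew _
  have hμ'0 : μ' ≠ 0 := MinSymp.mact_ne_zero hμ0 hUtu
  have hR : Ricac J0 μ' = Matrix.diagonal Λ := by
    have := MinSymp.Ricac_mact hskew hUt J
    rw [Matrix.transpose_transpose] at this
    rw [hJ0, hμ', this, hdiag]
  have hback : mact U μ' = μ := by
    rw [hμ', ← MinSymp.mact_mul, hU', MinSymp.mact_one]
  have hβ : Ricac J μ = U * Matrix.diagonal Λ * Uᵀ := by
    rw [← hdiag]
    calc Ricac J μ = (U * Uᵀ) * Ricac J μ * (U * Uᵀ) := by rw [hU']; simp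
      _ = _ := by simp only [Matrix.mul_assoc]
  have hF0 : Matrix.trace (Ricac J0 μ' * Ricac J0 μ') / (normSqV μ') ^ 2 =
      Matrix.trace (Ricac J μ * Ricac J μ) / (normSqV μ) ^ 2 := by
    have := MinSymp.F_mact hskew hUt J
    rwa [Matrix.transpose_transpose] at this
  constructor
  · intro hmin
    have hanti0 := MinSymp.Ricac_anti hJ0sq μ'
    rw [hR] at hanti0
    have hentry : ∀ i j, J0 i j ≠ 0 → Λ i + Λ j = 0 := by
      intro i j hij
      have := congrFun (congrFun hanti0 i) j
      rw [Matrix.neg_apply, Matrix.diagonal_mul, Matrix.mul_diagonal] at this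
      have h2 : (Λ i + Λ j) * J0 i j = 0 := by linarith
      exact (mul_eq_zero.1 h2).resolve_right hij
    obtain ⟨s, hs⟩ := MinSymp.core_crit hJ0sq hskew' hμ'0 hR (by
      intro t
      set E : Matrix (Fin (2 * n)) (Fin (2 * n)) ℝ :=
        Matrix.diagonal fun i => Real.exp (t * Λ i) with hE
      have hEJ : E * J0 * E = J0 := by
        ext i j
        rw [hE, Matrix.mul_diagonal, Matrix.diagonal_mul]
        by_cases hij : J0 i j = 0
        · simp [hij]
        · have h1 := hentry i j hij
          have h2 : Real.exp (t * Λ i) * Real.exp (t * Λ j) = 1 := by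
            rw [← Real.exp_add, ← mul_add, h1, mul_zero, Real.exp_zero]
          linear_combination J0 i j * h2
      have hEu : IsUnit E := by
        rw [Matrix.isUnit_iff_isUnit_det, hE, Matrix.det_diagonal, isUnit_iff_ne_zero]
        exact Finset.prod_ne_zero_iff.2 fun i _ => (Real.exp_pos _).ne'
      have hEt : Eᵀ = E := Matrix.diagonal_transpose _
      have hJback : J = U * J0 * Uᵀ := by
        rw [hJ0]
        calc J = (U * Uᵀ) * J * (U * Uᵀ) := by rw [hU']; simp
          _ = _ := by simp only [Matrix.mul_assoc]
      have hg : IsSymplMat J (U * E * Uᵀ) := by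
        refine ⟨(hUu.mul hEu).mul hUtu, fun X Y => ?_⟩
        have h1 : (U * E * Uᵀ)ᵀ * J * (U * E * Uᵀ) = J := by
          calc (U * E * Uᵀ)ᵀ * J * (U * E * Uᵀ) = U * (E * (Uᵀ * J * U) * E) * Uᵀ := by
                simp only [Matrix.transpose_mul, Matrix.transpose_transpose, hEt, Matrix.mul_assoc]
            _ = J := by rw [← hJ0, hEJ, ← hJback]
        simp only [sympForm]
        nth_rewrite 2 [← h1]
        simp only [← Matrix.mulVec_mulVec]
        rw [Matrix.dotProduct_mulVec X, Matrix.vecMul_transpose]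
        simp only [Matrix.mulVec_mulVec, Matrix.mul_assoc]
      have h2 := hmin _ hg
      have h3 := MinSymp.F_mact (MinSymp.skew_mact hskew (U * E * Uᵀ)) hUt J
      rw [Matrix.transpose_transpose, ← MinSymp.mact_mul] at h3
      have h4 : Uᵀ * (U * E * Uᵀ) = E * Uᵀ := by
        rw [← Matrix.mul_assoc, ← Matrix.mul_assoc, hU, Matrix.one_mul]
      rw [h4, MinSymp.mact_mul] at h3
      rw [hF0]
      rw [← h3] at h2
      exact h2)
    refine ⟨-s, Ricac J μ + s • (1 : Matrix (Fin (2 * n)) (Fin (2 * n)) ℝ), ?_, ?_⟩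
    · have hd : IsDerivation μ' (Matrix.diagonal fun i => Λ i + s) := by
        rw [MinSymp.der_diag hskew']
        intro a b c
        linear_combination hs a b c
      have h1 := MinSymp.der_mact hUu hd
      rw [hback, hUi] at h1
      have h2 : Ricac J μ + s • (1 : Matrix (Fin (2 * n)) (Fin (2 * n)) ℝ) =
          U * (Matrix.diagonal fun i => Λ i + s) * Uᵀ := by
        have : (Matrix.diagonal fun i => Λ i + s) =
            Matrix.diagonal Λ + s • (1 : Matrix (Fin (2 * n)) (Fin (2 * n)) ℝ) := by
          rw [Matrix.smul_one_eq_diagonal, Matrix.diagonal_add]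
        rw [this, hβ]
        simp [Matrix.mul_add, Matrix.add_mul, hU']
      rw [h2]
      exact h1
    · simp
  · rintro ⟨c, D, hD, hc⟩ g hg
    have hD' : IsDerivation μ' (Matrix.diagonal fun i => Λ i - c) := by
      have h1 := MinSymp.der_mact hUtu hD
      rw [hUti] at h1
      have h2 : Uᵀ * D * U = Matrix.diagonal fun i => Λ i - c := by
        have h3 : D = Ricac J μ - c • (1 : Matrix (Fin (2 * n)) (Fin (2 * n)) ℝ) := by
          rw [hc]; simp
        have : (Matrix.diagonal fun i => Λ i - c) =
            Matrix.diagonal Λ - c • (1 : Matrix (Fin (2 * n)) (Fin (2 * n)) ℝ) := by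
          rw [Matrix.smul_one_eq_diagonal, Matrix.diagonal_sub]
        rw [h3, this, Matrix.mul_sub, Matrix.sub_mul, hdiag]
        simp [hU]
      rw [h2] at h1
      exact h1
    rw [MinSymp.der_diag hskew'] at hD'
    obtain ⟨f, hf, hft⟩ := htri g hg
    have hV := horth f hf
    have hJV := hJU f hf
    set V := MinSymp.fmat J f
    have hV' : V * Vᵀ = 1 := mul_eq_one_comm.1 hV
    have hVt : (Vᵀ)ᵀ * Vᵀ = 1 := by rw [Matrix.transpose_transpose, hV']
    have hVtu : IsUnit Vᵀ := IsUnit.of_mul_eq_one _ hV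
    have hF1 := MinSymp.F_mact (MinSymp.skew_mact hskew g) hVt J
    rw [Matrix.transpose_transpose, ← hJV] at hF1
    set h := Vᵀ * g * U with hh
    have hhu : IsUnit h := (hVtu.mul hg.1).mul hUu
    have hνeq : mact Vᵀ (mact g μ) = mact h μ' := by
      rw [hμ', ← MinSymp.mact_mul, ← MinSymp.mact_mul, hh, Matrix.mul_assoc _ U, hU', Matrix.mul_one]
    rw [hνeq] at hF1
    rw [← hF0, ← hF1]
    have hbt : Matrix.BlockTriangular h (fun i => OrderDual.toDual (Λ i)) := by
      intro i j hij
      by_contra hne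
      exact absurd (hft i j hne) (not_le.2 (OrderDual.toDual_lt_toDual.1 hij))
    have hbti : Matrix.BlockTriangular h⁻¹ (fun i => OrderDual.toDual (Λ i)) := by
      have := hhu.invertible
      exact Matrix.blockTriangular_inv_of_blockTriangular hbt
    have hfti : ∀ i j, h⁻¹ i j ≠ 0 → Λ j ≤ Λ i := by
      intro i j hne
      by_contra hlt
      exact hne (hbti (OrderDual.toDual_lt_toDual.2 (not_le.1 hlt)))
    refine MinSymp.core_min (s := -c) hJ0sq hJ0s hskew' (MinSymp.skew_mact hskew' h) hμ'0
      (MinSymp.mact_ne_zero hμ'0 hhu) hR (fun a b k => by linear_combination hD' a b k) ?_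
    intro a b k hne
    rw [MinSymp.mact_coord hskew'] at hne
    obtain ⟨i, -, hi⟩ := Finset.exists_ne_zero_of_sum_ne_zero hne
    obtain ⟨j, -, hj⟩ := Finset.exists_ne_zero_of_sum_ne_zero hi
    obtain ⟨p, -, hp⟩ := Finset.exists_ne_zero_of_sum_ne_zero hj
    have n1 := left_ne_zero_of_mul hp
    have n2 := right_ne_zero_of_mul hp
    have n3 := left_ne_zero_of_mul n1
    have n4 := right_ne_zero_of_mul n1
    have n5 := left_ne_zero_of_mul n3
    have n6 := right_ne_zero_of_mul n3
    have w1 := hft k p n5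
    have w2 := hfti i a n6
    have w3 := hfti j b n4
    have w4 := (mul_eq_zero.1 (hD' i j p)).resolve_right n2
    linarith
end
end

section
/- Let μ ∈ N be nonzero and let g ∈ Sp(n,ℝ). Suppose Ric^{ac}_μ = c·I + D for some c ∈ ℝ and D ∈ Der(μ), and also Ric^{ac}_{g.μ} = c′·I + D′ for some c′ ∈ ℝ and D′ ∈ Der(g.μ). Then there exist k ∈ U(n) and t ≠ 0 such that g.μ = t·(k.μ). (A minimal compatible metric on an (almost-)symplectic nilpotent Lie group is unique up to isometry and scaling.) -/
open scoped BigOperators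
open Matrix

noncomputable section

/-! ### Block decomposition of positive definite symplectic matrices -/

/-- degree-zero part with respect to a grading. -/
def dz {m : ℕ} (a : Fin m → ℝ) (M : Matrix (Fin m) (Fin m) ℝ) : Matrix (Fin m) (Fin m) ℝ :=
  Matrix.of fun i j => if a i = a j then M i j else 0

lemma dz_apply {m : ℕ} (a : Fin m → ℝ) (M : Matrix (Fin m) (Fin m) ℝ) (i j : Fin m) :
    dz a M i j = if a i = a j then M i j else 0 := rfl

lemma dz_one {m : ℕ} (a : Fin m → ℝ) : dz a 1 = 1 := by
  ext i j
  rw [dz_apply]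
  by_cases h : i = j
  · subst h; simp
  · simp [h]

lemma dz_dz {m : ℕ} (a : Fin m → ℝ) (M : Matrix (Fin m) (Fin m) ℝ) :
    dz a (dz a M) = dz a M := by
  ext i j
  simp only [dz_apply]
  split_ifs <;> rfl

lemma dz_transpose {m : ℕ} (a : Fin m → ℝ) (M : Matrix (Fin m) (Fin m) ℝ) :
    dz a Mᵀ = (dz a M)ᵀ := by
  ext i j
  simp only [dz_apply, transpose_apply, eq_comm]

lemma dz_diagonal {m : ℕ} (a d : Fin m → ℝ) : dz a (diagonal d) = diagonal d := by
  ext i j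
  rw [dz_apply]
  by_cases h : i = j
  · subst h; simp
  · simp [h]

lemma dz_mul {m : ℕ} (a : Fin m → ℝ) (M N : Matrix (Fin m) (Fin m) ℝ)
    (hM : M.BlockTriangular a) (hN : N.BlockTriangular a) :
    dz a (M * N) = dz a M * dz a N := by
  ext i j
  rw [dz_apply, mul_apply, mul_apply]
  simp only [dz_apply]
  by_cases h : a i = a j
  · rw [if_pos h]
    apply Finset.sum_congr rfl
    intro k _
    by_cases h1 : a i = a k
    · rw [if_pos h1, if_pos (h1.symm.trans h)]
    · rw [if_neg h1, zero_mul]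
      rcases lt_or_gt_of_ne h1 with h2 | h2
      · rw [hN (by rw [← h]; exact h2), mul_zero]
      · rw [hM h2, zero_mul]
  · rw [if_neg h]
    symm
    apply Finset.sum_eq_zero
    intro k _
    by_cases h1 : a i = a k
    · rw [if_neg (fun h2 => h (h1.trans h2)), mul_zero]
    · rw [if_neg h1, zero_mul]

lemma dz_bt {m : ℕ} (a : Fin m → ℝ) (M : Matrix (Fin m) (Fin m) ℝ) (h : dz a M = M) :
    M.BlockTriangular a := by
  intro i j hij
  rw [← h, dz_apply, if_neg hij.ne']

lemma dz_mul_eq {m : ℕ} (a : Fin m → ℝ) (M N : Matrix (Fin m) (Fin m) ℝ)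
    (hM : dz a M = M) (hN : dz a N = N) : dz a (M * N) = M * N := by
  rw [dz_mul a M N (dz_bt a M hM) (dz_bt a N hN), hM, hN]

lemma bt_inv {m : ℕ} (a : Fin m → ℝ) (M : Matrix (Fin m) (Fin m) ℝ) (hu : IsUnit M)
    (h : M.BlockTriangular a) : (M⁻¹).BlockTriangular a := by
  have := hu.invertible
  exact blockTriangular_inv_of_blockTriangular h

lemma inv_mul_u {m : ℕ} {M : Matrix (Fin m) (Fin m) ℝ} (hu : IsUnit M) : M⁻¹ * M = 1 :=
  nonsing_inv_mul M ((isUnit_iff_isUnit_det M).1 hu)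

lemma mul_inv_u {m : ℕ} {M : Matrix (Fin m) (Fin m) ℝ} (hu : IsUnit M) : M * M⁻¹ = 1 :=
  mul_nonsing_inv M ((isUnit_iff_isUnit_det M).1 hu)

lemma unit_of_left {m : ℕ} {M N : Matrix (Fin m) (Fin m) ℝ} (h : M * N = 1) : IsUnit M :=
  IsUnit.of_mul_eq_one N h

lemma unit_of_right {m : ℕ} {M N : Matrix (Fin m) (Fin m) ℝ} (h : M * N = 1) : IsUnit N :=
  unit_of_left (mul_eq_one_comm.1 h)

lemma unit_inv {m : ℕ} {M : Matrix (Fin m) (Fin m) ℝ} (hu : IsUnit M) : IsUnit M⁻¹ :=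
  unit_of_left (inv_mul_u hu)

lemma unit_tr {m : ℕ} {M : Matrix (Fin m) (Fin m) ℝ} (hu : IsUnit M) : IsUnit Mᵀ := by
  apply unit_of_left (N := (M⁻¹)ᵀ)
  rw [← transpose_mul, inv_mul_u hu, transpose_one]

lemma dz_inv {m : ℕ} (a : Fin m → ℝ) (M : Matrix (Fin m) (Fin m) ℝ) (hu : IsUnit M)
    (h : M.BlockTriangular a) : dz a M * dz a M⁻¹ = 1 := by
  rw [← dz_mul a _ _ h (bt_inv a M hu h), mul_inv_u hu, dz_one]

lemma ldl_unique {m : ℕ} (a : Fin m → ℝ) (u u' d d' : Matrix (Fin m) (Fin m) ℝ)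
    (hu : u.BlockTriangular a) (hu' : u'.BlockTriangular a) (hu0 : dz a u = 1) (hu0' : dz a u' = 1)
    (hd : dz a d = d) (hd' : dz a d' = d') (uu : IsUnit u) (uu' : IsUnit u') (ud : IsUnit d)
    (h : uᵀ * d * u = u'ᵀ * d' * u') : u = u' ∧ d = d' := by
  have hi := inv_mul_u uu
  have hi' := inv_mul_u uu'
  have hj := mul_inv_u uu
  have hj' := mul_inv_u uu'
  have hw : (u * u'⁻¹).BlockTriangular a := hu.mul (bt_inv a _ uu' hu')
  have hv : (u' * u⁻¹).BlockTriangular a := hu'.mul (bt_inv a _ uu hu)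
  have h0' : dz a u'⁻¹ = 1 := by
    have := dz_inv a u' uu' hu'
    rwa [hu0', one_mul] at this
  have hw0 : dz a (u * u'⁻¹) = 1 := by
    rw [dz_mul a _ _ hu (bt_inv a _ uu' hu'), hu0, h0', one_mul]
  have key : d * (u * u'⁻¹) = (u' * u⁻¹)ᵀ * d' := by
    have e1 : (u⁻¹)ᵀ * uᵀ = 1 := by rw [← transpose_mul, hj, transpose_one]
    calc d * (u * u'⁻¹) = ((u⁻¹)ᵀ * uᵀ) * d * u * u'⁻¹ := by rw [e1]; noncomm_ring
      _ = (u⁻¹)ᵀ * (uᵀ * d * u) * u'⁻¹ := by noncomm_ring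
      _ = (u⁻¹)ᵀ * u'ᵀ * d' * (u' * u'⁻¹) := by rw [h]; noncomm_ring
      _ = _ := by rw [hj', transpose_mul, mul_one]
  have h1 : (d * (u * u'⁻¹)).BlockTriangular a := (dz_bt a d hd).mul hw
  have h2 : dz a (d * (u * u'⁻¹)) = d * (u * u'⁻¹) := by
    ext i j
    rw [dz_apply]
    split_ifs with hij
    · rfl
    · rcases lt_or_gt_of_ne hij with h3 | h3
      · have h4 : ((u' * u⁻¹)ᵀ * d')ᵀ.BlockTriangular a := by
          rw [transpose_mul, transpose_transpose]
          refine BlockTriangular.mul (dz_bt a _ ?_) hv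
          rw [dz_transpose, hd']
        rw [key]
        exact (h4 h3).symm
      · exact (h1 h3).symm
  rw [dz_mul a _ _ (dz_bt a d hd) hw, hd, hw0, mul_one] at h2
  have h3 : u * u'⁻¹ = 1 := by
    have := congrArg (fun x => d⁻¹ * x) h2
    simp only [← mul_assoc] at this
    rw [inv_mul_u ud, one_mul] at this
    exact this.symm
  have h4 : u = u' := by
    calc u = u * (u'⁻¹ * u') := by rw [hi', mul_one]
      _ = u' := by rw [← mul_assoc, h3, one_mul]
  refine ⟨h4, ?_⟩
  have h5 : u' * u⁻¹ = 1 := by rw [← h4, hj]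
  rw [h3, h5, transpose_one, one_mul, mul_one] at key
  exact key

lemma ldl_exists {m : ℕ} (a : Fin m → ℝ) (S : Matrix (Fin m) (Fin m) ℝ) (hS : S.PosDef) :
    ∃ (T : Matrix (Fin m) (Fin m) ℝ) (d : Fin m → ℝ), IsUnit T ∧ T.BlockTriangular a ∧
      Tᵀ * S * T = diagonal d := by
  set σ := Tuple.sort a with hσ
  have hmono : Monotone (a ∘ σ) := Tuple.monotone_sort a
  have hS' : (S.submatrix σ σ).PosDef := hS.submatrix σ.injective
  set Λ := LDL.lowerInv hS' with hΛ
  have e := LDL.diag_eq_lowerInv_conj hS'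
  have ht : ∀ i j, i < j → Λ i j = 0 := fun i j h => LDL.lowerInv_triangular hS' h
  have hI : IsUnit Λ := isUnit_of_invertible Λ
  refine ⟨Λᵀ.submatrix σ.symm σ.symm, LDL.diagEntries hS' ∘ σ.symm, ?_, ?_, ?_⟩
  · apply unit_of_left (N := (Λ⁻¹)ᵀ.submatrix σ.symm σ.symm)
    rw [submatrix_mul_equiv, ← transpose_mul, inv_mul_u hI]
    simp
  · intro i j hij
    simp only [submatrix_apply, transpose_apply]
    apply ht
    by_contra hh
    push Not at hh
    have := hmono hh
    simp at this
    linarith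
  · have e2 : S = (S.submatrix σ σ).submatrix σ.symm σ.symm := by simp
    conv_lhs => rw [e2]
    rw [transpose_submatrix, submatrix_mul_equiv, submatrix_mul_equiv, transpose_transpose]
    rw [conjTranspose_eq_transpose_of_trivial] at e
    rw [← e, LDL.diag]
    simp

lemma spec_exists {m : ℕ} (A : Matrix (Fin m) (Fin m) ℝ) (hA : Aᵀ = A) :
    ∃ (Q : Matrix (Fin m) (Fin m) ℝ) (d : Fin m → ℝ), Qᵀ * Q = 1 ∧ A = Q * diagonal d * Qᵀ := by
  have h : A.IsHermitian := by rw [IsHermitian, conjTranspose_eq_transpose_of_trivial, hA]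
  refine ⟨h.eigenvectorUnitary, h.eigenvalues, ?_, ?_⟩
  · have := Unitary.coe_star_mul_self h.eigenvectorUnitary
    rwa [star_eq_conjTranspose, conjTranspose_eq_transpose_of_trivial] at this
  · have := h.spectral_theorem
    rw [Unitary.conjStarAlgAut_apply] at this
    rw [star_eq_conjTranspose, conjTranspose_eq_transpose_of_trivial] at this
    simpa using this

lemma spec_pos {m : ℕ} (A : Matrix (Fin m) (Fin m) ℝ) (hA : A.PosDef) :
    ∃ (Q : Matrix (Fin m) (Fin m) ℝ) (d : Fin m → ℝ), Qᵀ * Q = 1 ∧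
      A = Q * diagonal (fun i => Real.exp (2 * d i)) * Qᵀ := by
  have h1 : Aᵀ = A := by
    have := hA.1
    rwa [IsHermitian, conjTranspose_eq_transpose_of_trivial] at this
  obtain ⟨Q, e, hQ, hE⟩ := spec_exists A h1
  have hpos : (diagonal e).PosDef := by
    have h2 := hA.conjTranspose_mul_mul_same (B := Q) (by
      have : Function.LeftInverse Qᵀ.mulVec Q.mulVec := by
        intro x; rw [mulVec_mulVec, hQ, one_mulVec]
      exact this.injective)
    rw [conjTranspose_eq_transpose_of_trivial] at h2
    convert h2 using 1
    rw [hE]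
    calc diagonal e = (Qᵀ * Q) * diagonal e * (Qᵀ * Q) := by rw [hQ]; simp
      _ = _ := by noncomm_ring
  rw [posDef_diagonal_iff] at hpos
  refine ⟨Q, fun i => Real.log (e i) / 2, hQ, ?_⟩
  rw [hE]
  congr 3
  funext i
  rw [mul_div_cancel₀ _ (two_ne_zero), Real.exp_log (hpos i)]

lemma jconj_apply {m : ℕ} (J M : Matrix (Fin m) (Fin m) ℝ) (i j : Fin m) :
    (Jᵀ * M * J) i j = ∑ l, ∑ k, J k i * M k l * J l j := by
  rw [mul_apply]
  apply Finset.sum_congr rfl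
  intro l _
  rw [mul_apply, Finset.sum_mul]
  rfl

lemma jconj_bt {m : ℕ} (a : Fin m → ℝ) (J M : Matrix (Fin m) (Fin m) ℝ)
    (hJa : ∀ i j, J i j ≠ 0 → a i + a j = 0) (hM : Mᵀ.BlockTriangular a) :
    (Jᵀ * M * J).BlockTriangular a := by
  intro i j hij
  rw [jconj_apply]
  refine Finset.sum_eq_zero fun l _ => Finset.sum_eq_zero fun k _ => ?_
  by_cases h1 : J k i = 0
  · rw [h1, zero_mul, zero_mul]
  by_cases h2 : J l j = 0
  · rw [h2, mul_zero]
  have e1 := hJa _ _ h1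
  have e2 := hJa _ _ h2
  have : M k l = 0 := hM (i := l) (j := k) (by linarith)
  rw [this, mul_zero, zero_mul]

lemma jconj_dz {m : ℕ} (a : Fin m → ℝ) (J M : Matrix (Fin m) (Fin m) ℝ)
    (hJa : ∀ i j, J i j ≠ 0 → a i + a j = 0) :
    dz a (Jᵀ * M * J) = Jᵀ * dz a M * J := by
  ext i j
  rw [dz_apply, jconj_apply, jconj_apply]
  have key : ∀ l k, J k i * dz a M k l * J l j =
      if a i = a j then J k i * M k l * J l j else 0 := by
    intro l k
    by_cases h1 : J k i = 0
    · simp [h1]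
    by_cases h2 : J l j = 0
    · simp [h2]
    have e1 := hJa _ _ h1
    have e2 := hJa _ _ h2
    rw [dz_apply]
    by_cases h : a i = a j
    · rw [if_pos h, if_pos (by linarith)]
    · rw [if_neg h, if_neg (fun h' => h (by linarith))]
      simp
  simp only [key]
  split_ifs with h
  · rfl
  · simp

lemma diag_conj {m : ℕ} (Q : Matrix (Fin m) (Fin m) ℝ) (hQ : Qᵀ * Q = 1) (e f : Fin m → ℝ)
    (X Y : Matrix (Fin m) (Fin m) ℝ) :
    (Q * diagonal e * Qᵀ) * X * (Q * diagonal f * Qᵀ) = Y ↔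
      ∀ i j, e i * (Qᵀ * X * Q) i j * f j = (Qᵀ * Y * Q) i j := by
  have hQ' : Q * Qᵀ = 1 := mul_eq_one_comm.1 hQ
  have h1 : (Q * diagonal e * Qᵀ) * X * (Q * diagonal f * Qᵀ) = Y ↔
      diagonal e * (Qᵀ * X * Q) * diagonal f = Qᵀ * Y * Q := by
    constructor
    · intro h
      rw [← h]
      calc diagonal e * (Qᵀ * X * Q) * diagonal f
          = (Qᵀ * Q) * diagonal e * (Qᵀ * X * Q) * diagonal f * (Qᵀ * Q) := by
            rw [hQ, one_mul, mul_one]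
        _ = _ := by noncomm_ring
    · intro h
      calc (Q * diagonal e * Qᵀ) * X * (Q * diagonal f * Qᵀ)
          = Q * (diagonal e * (Qᵀ * X * Q) * diagonal f) * Qᵀ := by noncomm_ring
        _ = (Q * Qᵀ) * Y * (Q * Qᵀ) := by rw [h]; noncomm_ring
        _ = Y := by rw [hQ', one_mul, mul_one]
  rw [h1, ← Matrix.ext_iff]
  simp only [mul_diagonal, diagonal_mul]

lemma exp_root_aux (x y z : ℝ) (h : Real.exp (2 * x) * z * Real.exp (2 * y) = z) :
    z = 0 ∨ x + y = 0 := by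
  by_cases hz : z = 0
  · exact Or.inl hz
  · right
    have h1 : Real.exp (2 * x + 2 * y) = 1 := by
      rw [Real.exp_add]
      apply mul_left_cancel₀ hz
      linarith
    rw [Real.exp_eq_one_iff] at h1
    linarith

lemma decomp {m : ℕ} (a : Fin m → ℝ) (J g : Matrix (Fin m) (Fin m) ℝ) (hJt : Jᵀ = -J)
    (hJ : J * J = -1) (hJa : ∀ i j, J i j ≠ 0 → a i + a j = 0) (hg : gᵀ * J * g = J) :
    ∃ (p P Q : Matrix (Fin m) (Fin m) ℝ) (δ : Fin m → ℝ), pᵀ * p = gᵀ * g ∧ pᵀ * J * p = J ∧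
      p.BlockTriangular a ∧ dz a p = P ∧ dz a p⁻¹ = P⁻¹ ∧
      P = Q * diagonal (fun i => Real.exp (δ i)) * Qᵀ ∧ Qᵀ * Q = 1 ∧ P * J * P = J := by
  have hJJ : Jᵀ * J = 1 := by rw [hJt, neg_mul, hJ, neg_neg]
  have hJJ' : J * Jᵀ = 1 := mul_eq_one_comm.1 hJJ
  have hgl : (Jᵀ * gᵀ * J) * g = 1 := by
    calc (Jᵀ * gᵀ * J) * g = Jᵀ * (gᵀ * J * g) := by noncomm_ring
      _ = 1 := by rw [hg, hJJ]
  have hgr : g * (Jᵀ * gᵀ * J) = 1 := mul_eq_one_comm.1 hgl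
  have ug : IsUnit g := unit_of_left hgr
  have hgr2 : g * J * gᵀ = J := by
    have h1 : g * Jᵀ * gᵀ = Jᵀ := by
      calc g * Jᵀ * gᵀ = (g * (Jᵀ * gᵀ * J)) * Jᵀ := by
            simp only [mul_assoc, hJJ', mul_one]
        _ = _ := by rw [hgr, one_mul]
    rw [hJt] at h1
    simpa using h1
  set S := gᵀ * g with hS
  have hSJS : S * J * S = J := by
    calc S * J * S = gᵀ * (g * J * gᵀ) * g := by rw [hS]; noncomm_ring
      _ = J := by rw [hgr2, hg]
  have hSp : S.PosDef := by
    have := PosDef.conjTranspose_mul_self g (by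
      have : Function.LeftInverse g⁻¹.mulVec g.mulVec := by
        intro x; rw [mulVec_mulVec, inv_mul_u ug, one_mulVec]
      exact this.injective)
    rwa [conjTranspose_eq_transpose_of_trivial] at this
  obtain ⟨T, e, uT, bT, hT⟩ := ldl_exists a S hSp
  have bTi := bt_inv a T uT bT
  have hz := dz_inv a T uT bT
  have hz' : dz a T⁻¹ * dz a T = 1 := mul_eq_one_comm.1 hz
  set Z := dz a T with hZ
  set W := dz a T⁻¹ with hW
  set u := Z * T⁻¹ with hu
  set d := Wᵀ * diagonal e * W with hd
  have hTi := mul_inv_u uT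
  have hTi' := inv_mul_u uT
  have uu : IsUnit u := by
    apply unit_of_left (N := T * W)
    rw [hu, mul_assoc, ← mul_assoc T⁻¹, hTi', one_mul, hz]
  have hZ0 : dz a Z = Z := dz_dz a T
  have hW0 : dz a W = W := dz_dz a _
  have bu : u.BlockTriangular a := (dz_bt a Z hZ0).mul bTi
  have u0 : dz a u = 1 := by
    rw [hu, dz_mul a _ _ (dz_bt a Z hZ0) bTi, hZ0, hz]
  have d0 : dz a d = d := by
    apply dz_mul_eq _ _ _ _ hW0
    apply dz_mul_eq _ _ _ _ (dz_diagonal a e)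
    rw [dz_transpose, hW0]
  have hudu : uᵀ * d * u = S := by
    have e1 : Zᵀ * Wᵀ = 1 := by rw [← transpose_mul, hz', transpose_one]
    have e2 : (T⁻¹)ᵀ * Tᵀ = 1 := by rw [← transpose_mul, hTi, transpose_one]
    calc uᵀ * d * u = (T⁻¹)ᵀ * (Zᵀ * Wᵀ) * diagonal e * (W * Z) * T⁻¹ := by
          rw [hu, hd, transpose_mul]; noncomm_ring
      _ = ((T⁻¹)ᵀ * Tᵀ) * S * (T * T⁻¹) := by
          rw [e1, hz', ← hT]; noncomm_ring
      _ = S := by rw [e2, hTi]; simp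
  have hui := mul_inv_u uu
  have hui' := inv_mul_u uu
  have huit : uᵀ * (u⁻¹)ᵀ = 1 := by rw [← transpose_mul, hui', transpose_one]
  have huit' : (u⁻¹)ᵀ * uᵀ = 1 := mul_eq_one_comm.1 huit
  have hdS : d = (u⁻¹)ᵀ * S * u⁻¹ := by
    rw [← hudu]
    calc d = ((u⁻¹)ᵀ * uᵀ) * d * (u * u⁻¹) := by rw [huit', hui]; simp
      _ = _ := by noncomm_ring
  have dp : d.PosDef := by
    have := hSp.conjTranspose_mul_mul_same (B := u⁻¹) (by
      have : Function.LeftInverse u.mulVec u⁻¹.mulVec := by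
        intro x; rw [mulVec_mulVec, hui, one_mulVec]
      exact this.injective)
    rw [conjTranspose_eq_transpose_of_trivial] at this
    rwa [hdS]
  have ud : IsUnit d := dp.isUnit
  have hdi := mul_inv_u ud
  have hdi' := inv_mul_u ud
  have d0i : dz a d⁻¹ = d⁻¹ := by
    have := dz_inv a d ud (dz_bt a d d0)
    rw [d0] at this
    exact (inv_eq_right_inv this).symm
  have ui0 : dz a u⁻¹ = 1 := by
    have := dz_inv a u uu bu
    rwa [u0, one_mul] at this
  have huniq := ldl_unique a u (Jᵀ * (u⁻¹)ᵀ * J) d (Jᵀ * d⁻¹ * J) bu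
    (jconj_bt a J _ hJa (by rw [transpose_transpose]; exact bt_inv a u uu bu)) u0
    (by rw [jconj_dz a J _ hJa, dz_transpose, ui0, transpose_one, mul_one, hJJ]) d0
    (by rw [jconj_dz a J _ hJa, d0i]) uu
    (by
      apply unit_of_left (N := Jᵀ * uᵀ * J)
      calc Jᵀ * (u⁻¹)ᵀ * J * (Jᵀ * uᵀ * J) = Jᵀ * (u⁻¹)ᵀ * (J * Jᵀ) * uᵀ * J := by noncomm_ring
        _ = Jᵀ * ((u⁻¹)ᵀ * uᵀ) * J := by rw [hJJ']; noncomm_ring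
        _ = 1 := by rw [huit', mul_one, hJJ]) ud
    (by
      rw [hudu]
      set X := u⁻¹ * d⁻¹ * (u⁻¹)ᵀ with hX
      have hXS : X * S = 1 := by
        calc X * S = u⁻¹ * d⁻¹ * ((u⁻¹)ᵀ * uᵀ) * d * u := by rw [hX, ← hudu]; noncomm_ring
          _ = u⁻¹ * (d⁻¹ * d) * u := by rw [huit']; noncomm_ring
          _ = 1 := by rw [hdi', mul_one, hui']
      have h1 : J * S = X * J := by
        calc J * S = (X * S) * J * S := by rw [hXS, one_mul]
          _ = X * (S * J * S) := by noncomm_ring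
          _ = X * J := by rw [hSJS]
      symm
      calc (Jᵀ * (u⁻¹)ᵀ * J)ᵀ * (Jᵀ * d⁻¹ * J) * (Jᵀ * (u⁻¹)ᵀ * J)
          = Jᵀ * u⁻¹ * (J * Jᵀ) * d⁻¹ * (J * Jᵀ) * (u⁻¹)ᵀ * J := by
            simp only [transpose_mul, transpose_transpose]; noncomm_ring
        _ = Jᵀ * (X * J) := by rw [hJJ', hX]; noncomm_ring
        _ = S := by rw [← h1, ← mul_assoc, hJJ, one_mul])
  obtain ⟨hu1, hd1⟩ := huniq
  have huJ : uᵀ * J * u = J := by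
    have : J * u = (u⁻¹)ᵀ * J := by
      calc J * u = J * (Jᵀ * (u⁻¹)ᵀ * J) := congrArg (fun x => J * x) hu1
        _ = (J * Jᵀ) * (u⁻¹)ᵀ * J := by noncomm_ring
        _ = _ := by rw [hJJ', one_mul]
    rw [mul_assoc, this, ← mul_assoc, huit, one_mul]
  have hdJ : d * J * d = J := by
    have : J * d = d⁻¹ * J := by
      calc J * d = J * (Jᵀ * d⁻¹ * J) := congrArg (fun x => J * x) hd1
        _ = (J * Jᵀ) * d⁻¹ * J := by noncomm_ring
        _ = _ := by rw [hJJ', one_mul]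
    rw [mul_assoc, this, ← mul_assoc, hdi, one_mul]
  obtain ⟨Q, δ, hQ, hdQ⟩ := spec_pos d dp
  have hQ' : Q * Qᵀ = 1 := mul_eq_one_comm.1 hQ
  set P := Q * diagonal (fun i => Real.exp (δ i)) * Qᵀ with hP
  have hPt : Pᵀ = P := by
    rw [hP]; simp [transpose_mul, mul_assoc]
  have hPP : P * P = d := by
    calc P * P = Q * diagonal (fun i => Real.exp (δ i)) * (Qᵀ * Q) *
          diagonal (fun i => Real.exp (δ i)) * Qᵀ := by rw [hP]; noncomm_ring
      _ = Q * (diagonal (fun i => Real.exp (δ i)) * diagonal (fun i => Real.exp (δ i))) * Qᵀ := by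
          rw [hQ]; noncomm_ring
      _ = d := by
          rw [hdQ, diagonal_mul_diagonal]
          congr 3
          funext i
          rw [two_mul, Real.exp_add]
  have hPJ : P * J * P = J := by
    rw [hP, diag_conj Q hQ]
    intro i j
    rw [hdQ, diag_conj Q hQ] at hdJ
    rcases exp_root_aux _ _ _ (hdJ i j) with h | h
    · rw [h]; simp
    · have : Real.exp (δ i) * Real.exp (δ j) = 1 := by rw [← Real.exp_add, h, Real.exp_zero]
      linear_combination (Qᵀ * J * Q) i j * this
  have hPa : dz a P = P := by
    have hda : d * diagonal a = diagonal a * d := by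
      ext i j
      rw [mul_diagonal, diagonal_mul]
      rw [← d0, dz_apply]
      split_ifs with h
      · rw [h, mul_comm]
      · simp
    have hda2 : d * diagonal a * d⁻¹ = diagonal a := by
      rw [hda, mul_assoc, hdi, mul_one]
    have hdinv : d⁻¹ = Q * diagonal (fun i => Real.exp (2 * (-δ i))) * Qᵀ := by
      apply inv_eq_right_inv
      rw [hdQ]
      calc _ = Q * diagonal (fun i => Real.exp (2 * δ i)) * (Qᵀ * Q) *
            diagonal (fun i => Real.exp (2 * (-δ i))) * Qᵀ := by noncomm_ring
        _ = Q * (diagonal (fun i => Real.exp (2 * δ i)) *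
            diagonal (fun i => Real.exp (2 * (-δ i)))) * Qᵀ := by rw [hQ]; noncomm_ring
        _ = 1 := by
          rw [diagonal_mul_diagonal]
          have : (fun i => Real.exp (2 * δ i) * Real.exp (2 * (-δ i))) = fun _ => 1 := by
            funext i
            rw [← Real.exp_add]
            simp
          rw [this, diagonal_one, mul_one, hQ']
    have hPa2 : P * diagonal a * (Q * diagonal (fun i => Real.exp (-δ i)) * Qᵀ) = diagonal a := by
      rw [hP, diag_conj Q hQ]
      intro i j
      rw [hdinv, hdQ, diag_conj Q hQ] at hda2
      rcases exp_root_aux _ _ _ (hda2 i j) with h | h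
      · rw [h]; simp
      · have : Real.exp (δ i) * Real.exp (-δ j) = 1 := by rw [← Real.exp_add, h, Real.exp_zero]
        linear_combination (Qᵀ * diagonal a * Q) i j * this
    have hPinv : (Q * diagonal (fun i => Real.exp (-δ i)) * Qᵀ) * P = 1 := by
      rw [hP]
      calc _ = Q * diagonal (fun i => Real.exp (-δ i)) * (Qᵀ * Q) *
            diagonal (fun i => Real.exp (δ i)) * Qᵀ := by noncomm_ring
        _ = Q * (diagonal (fun i => Real.exp (-δ i)) *
            diagonal (fun i => Real.exp (δ i))) * Qᵀ := by rw [hQ]; noncomm_ring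
        _ = 1 := by
          rw [diagonal_mul_diagonal]
          have : (fun i => Real.exp (-δ i) * Real.exp (δ i)) = fun _ => 1 := by
            funext i
            rw [← Real.exp_add]
            simp
          rw [this, diagonal_one, mul_one, hQ']
    have hcomm : P * diagonal a = diagonal a * P := by
      conv_rhs => rw [← hPa2]
      rw [mul_assoc _ _ P, hPinv, mul_one]
    ext i j
    rw [dz_apply]
    split_ifs with h
    · rfl
    · have h1 := congrFun (congrFun hcomm i) j
      rw [mul_diagonal, diagonal_mul] at h1
      have h2 : (a i - a j) * P i j = 0 := by linarith
      rcases mul_eq_zero.1 h2 with h3 | h3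
      · exact absurd (by linarith) h
      · exact h3.symm
  have bP := dz_bt a P hPa
  have uP : IsUnit P := by
    apply unit_of_left (N := P * d⁻¹)
    rw [← mul_assoc, hPP, hdi]
  have bp : (P * u).BlockTriangular a := bP.mul bu
  have hp0 : dz a (P * u) = P := by rw [dz_mul a _ _ bP bu, hPa, u0, mul_one]
  refine ⟨P * u, P, Q, δ, ?_, ?_, bp, hp0, ?_, rfl, hQ, hPJ⟩
  · rw [transpose_mul, hPt, ← hudu, ← hPP]; noncomm_ring
  · calc (P * u)ᵀ * J * (P * u) = uᵀ * (P * J * P) * u := by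
          rw [transpose_mul, hPt]; noncomm_ring
      _ = J := by rw [hPJ, huJ]
  · have := dz_inv a (P * u) (uP.mul uu) bp
    rw [hp0] at this
    exact (inv_eq_right_inv this).symm

/-! ### Structure constants, the action and the Ricci operator -/

/-- structure constants. -/
def scon {m : ℕ} (μ : Bil m) (i j k : Fin m) : ℝ := μ (bvec m i) (bvec m j) k

lemma vec_expand {m : ℕ} (x : Vec m) : x = ∑ i, x i • bvec m i := by
  ext j
  simp [bvec, Finset.sum_apply, Pi.single_apply]

lemma bil_expand {m : ℕ} (μ : Bil m) (hμ : IsSkewBil μ) (x y : Vec m) (k : Fin m) :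
    μ x y k = ∑ i, ∑ j, x i * y j * scon μ i j k := by
  obtain ⟨h1, h2, -⟩ := hμ
  have e1 : ∀ y, μ x y = ∑ i, x i • μ (bvec m i) y := by
    intro y
    conv_lhs => rw [vec_expand x]
    refine (map_sum (h1 y).mk' (fun i => x i • bvec m i) Finset.univ).trans ?_
    exact Finset.sum_congr rfl fun i _ => (h1 y).map_smul (x i) (bvec m i)
  have e2 : ∀ i, μ (bvec m i) y = ∑ j, y j • μ (bvec m i) (bvec m j) := by
    intro i
    conv_lhs => rw [vec_expand y]
    refine (map_sum (h2 (bvec m i)).mk' (fun i => y i • bvec m i) Finset.univ).trans ?_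
    exact Finset.sum_congr rfl fun j _ => (h2 (bvec m i)).map_smul (y j) (bvec m j)
  rw [e1]
  simp only [e2, Finset.sum_apply, Pi.smul_apply, smul_eq_mul, Finset.mul_sum, scon]
  exact Finset.sum_congr rfl fun i _ => Finset.sum_congr rfl fun j _ => by ring

lemma scon_skew {m : ℕ} (μ : Bil m) (hμ : IsSkewBil μ) (i j k : Fin m) :
    scon μ j i k = - scon μ i j k := by
  rw [scon, hμ.2.2]; rfl

lemma bil_ext {m : ℕ} (μ ν : Bil m) (hμ : IsSkewBil μ) (hν : IsSkewBil ν)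
    (h : ∀ i j k, scon μ i j k = scon ν i j k) : μ = ν := by
  funext x y k
  rw [bil_expand μ hμ, bil_expand ν hν]
  simp only [h]

lemma mact_skew {m : ℕ} (g : Matrix (Fin m) (Fin m) ℝ) (μ : Bil m) (hμ : IsSkewBil μ) :
    IsSkewBil (mact g μ) := by
  obtain ⟨h1, h2, h3⟩ := hμ
  refine ⟨fun Y => ⟨fun x y => ?_, fun c x => ?_⟩, fun X => ⟨fun x y => ?_, fun c x => ?_⟩,
    fun X Y => ?_⟩
  · simp only [mact, mulVec_add, (h1 _).map_add]
  · simp only [mact, mulVec_smul, (h1 _).map_smul]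
  · simp only [mact, mulVec_add, (h2 _).map_add]
  · simp only [mact, mulVec_smul, (h2 _).map_smul]
  · simp only [mact]
    rw [h3, mulVec_neg]

lemma smul_skew {m : ℕ} (t : ℝ) (μ : Bil m) (hμ : IsSkewBil μ) :
    IsSkewBil (t • μ) := by
  obtain ⟨h1, h2, h3⟩ := hμ
  refine ⟨fun Y => ⟨fun x y => ?_, fun c x => ?_⟩, fun X => ⟨fun x y => ?_, fun c x => ?_⟩,
    fun X Y => ?_⟩
  · simp only [Pi.smul_apply, (h1 _).map_add, smul_add]
  · simp only [Pi.smul_apply, (h1 _).map_smul, smul_comm t c]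
  · simp only [Pi.smul_apply, (h2 _).map_add, smul_add]
  · simp only [Pi.smul_apply, (h2 _).map_smul, smul_comm t c]
  · simp only [Pi.smul_apply]
    rw [h3, smul_neg]

lemma mact_mact {m : ℕ} (g h : Matrix (Fin m) (Fin m) ℝ) (μ : Bil m) :
    mact g (mact h μ) = mact (g * h) μ := by
  funext x y
  simp only [mact, mulVec_mulVec, Matrix.mul_inv_rev]

lemma mact_one {m : ℕ} (μ : Bil m) : mact 1 μ = μ := by
  funext x y
  simp [mact]

lemma mact_smul {m : ℕ} (g : Matrix (Fin m) (Fin m) ℝ) (t : ℝ) (μ : Bil m) :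
    mact g (t • μ) = t • mact g μ := by
  funext x y
  simp [mact, mulVec_smul]

lemma scon_mact {m : ℕ} (g : Matrix (Fin m) (Fin m) ℝ) (μ : Bil m) (hμ : IsSkewBil μ)
    (i j k : Fin m) :
    scon (mact g μ) i j k = ∑ l, ∑ x, ∑ y, g k l * (g⁻¹ x i * g⁻¹ y j * scon μ x y l) := by
  have hb : ∀ (M : Matrix (Fin m) (Fin m) ℝ) (i x), M.mulVec (bvec m i) x = M x i := by
    intro M i x
    simp [bvec]
  simp only [scon, mact, mulVec, dotProduct]
  apply Finset.sum_congr rfl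
  intro l _
  have := bil_expand μ hμ (g⁻¹.mulVec (bvec m i)) (g⁻¹.mulVec (bvec m j)) l
  simp only [hb] at this
  change g k l * μ (g⁻¹.mulVec (bvec m i)) (g⁻¹.mulVec (bvec m j)) l = _
  rw [this]
  simp only [Finset.mul_sum]
  rfl

/-- Gram matrix of a family of matrices. -/
def gramM {m : ℕ} (M : Fin m → Matrix (Fin m) (Fin m) ℝ) : Matrix (Fin m) (Fin m) ℝ :=
  Matrix.of fun x y => ∑ i, ∑ j, M x i j * M y i j

lemma gram_conj {m : ℕ} (M N : Fin m → Matrix (Fin m) (Fin m) ℝ) (Q : Matrix (Fin m) (Fin m) ℝ)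
    (hQ : Qᵀ * Q = 1) (h : ∀ x, N x = ∑ a, Q x a • (Q * M a * Qᵀ)) :
    gramM N = Q * gramM M * Qᵀ := by
  have hg : ∀ (M : Fin m → Matrix (Fin m) (Fin m) ℝ) (x y), gramM M x y = trace (M x * (M y)ᵀ) := by
    intro M x y
    simp [gramM, trace, mul_apply]
  have hc : ∀ a b, trace ((Q * M a * Qᵀ) * (Q * M b * Qᵀ)ᵀ) = trace (M a * (M b)ᵀ) := by
    intro a b
    have : (Q * M a * Qᵀ) * (Q * M b * Qᵀ)ᵀ = Q * (M a * (Qᵀ * Q) * (M b)ᵀ * Qᵀ) := by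
      simp only [transpose_mul, transpose_transpose]; noncomm_ring
    rw [this, trace_mul_comm, hQ, mul_one, mul_assoc, hQ, mul_one]
  ext x y
  rw [hg, h, h, transpose_sum, Finset.sum_mul_sum, trace_sum, mul_apply]
  simp only [trace_sum, transpose_smul, smul_mul_smul_comm, trace_smul, hc, mul_apply,
    Finset.sum_mul, transpose_apply, hg, smul_eq_mul]
  rw [Finset.sum_comm]
  exact Finset.sum_congr rfl fun i _ => Finset.sum_congr rfl fun j _ => by ring

lemma RicM_eq {m : ℕ} (μ : Bil m) : RicM μ =
    (-(1/2) : ℝ) • gramM (fun x => Matrix.of fun i j => scon μ x i j) +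
      (1/4 : ℝ) • gramM (fun x => Matrix.of fun i j => scon μ i j x) := by
  ext x y
  rfl

lemma inv_orth {m : ℕ} {Q : Matrix (Fin m) (Fin m) ℝ} (hQ : Qᵀ * Q = 1) : Q⁻¹ = Qᵀ :=
  inv_eq_left_inv hQ

lemma gram1_mact {m : ℕ} (Q : Matrix (Fin m) (Fin m) ℝ) (hQ : Qᵀ * Q = 1) (μ : Bil m)
    (hμ : IsSkewBil μ) : gramM (fun x => Matrix.of fun i j => scon (mact Q μ) x i j) =
      Q * gramM (fun x => Matrix.of fun i j => scon μ x i j) * Qᵀ := by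
  apply gram_conj _ _ Q hQ
  intro x
  ext i j
  simp only [of_apply, scon_mact Q μ hμ, inv_orth hQ, transpose_apply, Matrix.sum_apply,
    Matrix.smul_apply, mul_apply, smul_eq_mul, Finset.sum_mul, Finset.mul_sum]
  rw [Finset.sum_comm]
  exact Finset.sum_congr rfl fun i _ => Finset.sum_congr rfl fun j _ =>
    Finset.sum_congr rfl fun k _ => by ring

lemma gram2_mact {m : ℕ} (Q : Matrix (Fin m) (Fin m) ℝ) (hQ : Qᵀ * Q = 1) (μ : Bil m)
    (hμ : IsSkewBil μ) : gramM (fun x => Matrix.of fun i j => scon (mact Q μ) i j x) =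
      Q * gramM (fun x => Matrix.of fun i j => scon μ i j x) * Qᵀ := by
  apply gram_conj _ _ Q hQ
  intro x
  ext i j
  simp only [of_apply, scon_mact Q μ hμ, inv_orth hQ, transpose_apply, Matrix.sum_apply,
    Matrix.smul_apply, mul_apply, smul_eq_mul, Finset.sum_mul, Finset.mul_sum]
  apply Finset.sum_congr rfl
  intro l _
  rw [Finset.sum_comm]
  exact Finset.sum_congr rfl fun j _ =>
    Finset.sum_congr rfl fun k _ => by ring

lemma RicM_mact {m : ℕ} (Q : Matrix (Fin m) (Fin m) ℝ) (hQ : Qᵀ * Q = 1) (μ : Bil m)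
    (hμ : IsSkewBil μ) : RicM (mact Q μ) = Q * RicM μ * Qᵀ := by
  rw [RicM_eq, RicM_eq, gram1_mact Q hQ μ hμ, gram2_mact Q hQ μ hμ]
  simp only [mul_add, add_mul, mul_smul_comm, smul_mul_assoc]

lemma normSqV_eq {m : ℕ} (μ : Bil m) : normSqV μ = ∑ i, ∑ j, ∑ k, scon μ i j k ^ 2 := rfl

lemma normSqV_trace {m : ℕ} (μ : Bil m) :
    normSqV μ = trace (gramM (fun x => Matrix.of fun i j => scon μ x i j)) := by
  simp only [normSqV_eq, trace, gramM, diag_apply, of_apply, pow_two]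

lemma normSqV_mact {m : ℕ} (Q : Matrix (Fin m) (Fin m) ℝ) (hQ : Qᵀ * Q = 1) (μ : Bil m)
    (hμ : IsSkewBil μ) : normSqV (mact Q μ) = normSqV μ := by
  rw [normSqV_trace, normSqV_trace, gram1_mact Q hQ μ hμ, mul_assoc, trace_mul_comm, mul_assoc, hQ,
    mul_one]

lemma normSqV_pos {m : ℕ} (μ : Bil m) (hμ : IsSkewBil μ) (h0 : μ ≠ 0) : 0 < normSqV μ := by
  have hnn : ∀ i j k, 0 ≤ scon μ i j k ^ 2 := fun i j k => sq_nonneg _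
  rw [normSqV_eq]
  by_contra hh
  apply h0
  have hs : ∑ i, ∑ j, ∑ k, scon μ i j k ^ 2 = 0 := le_antisymm (not_lt.1 hh)
    (Finset.sum_nonneg fun i _ => Finset.sum_nonneg fun j _ => Finset.sum_nonneg fun k _ => hnn i j k)
  have h0s : ∀ i j k, scon μ i j k = 0 := by
    intro i j k
    rw [Finset.sum_eq_zero_iff_of_nonneg (fun i _ => Finset.sum_nonneg fun j _ =>
      Finset.sum_nonneg fun k _ => hnn i j k)] at hs
    have h1 := hs i (Finset.mem_univ _)
    rw [Finset.sum_eq_zero_iff_of_nonneg (fun j _ => Finset.sum_nonneg fun k _ => hnn i j k)] at h1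
    have h2 := h1 j (Finset.mem_univ _)
    rw [Finset.sum_eq_zero_iff_of_nonneg (fun k _ => hnn i j k)] at h2
    exact pow_eq_zero_iff (two_ne_zero) |>.1 (h2 k (Finset.mem_univ _))
  funext x y k
  rw [bil_expand μ hμ]
  simp [h0s]

lemma RicM_symm {m : ℕ} (μ : Bil m) : (RicM μ)ᵀ = RicM μ := by
  ext x y
  simp only [transpose_apply, RicM, of_apply]
  simp only [mul_comm]

lemma trace_Ric_mul {m : ℕ} (μ : Bil m) (E : Matrix (Fin m) (Fin m) ℝ) :
    trace (RicM μ * E) =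
      -(1/2) * (∑ i, ∑ j, ∑ k, ∑ x, E x i * scon μ x j k * scon μ i j k) +
      (1/4) * (∑ i, ∑ j, ∑ k, ∑ x, E k x * scon μ i j x * scon μ i j k) := by
  have h1 : trace (gramM (fun x => Matrix.of fun i j => scon μ x i j) * E) =
      ∑ i, ∑ j, ∑ k, ∑ x, E x i * scon μ x j k * scon μ i j k := by
    simp only [trace, diag_apply, mul_apply, gramM, of_apply, Finset.sum_mul]
    apply Finset.sum_congr rfl
    intro i _
    rw [Finset.sum_comm]
    apply Finset.sum_congr rfl
    intro j _
    rw [Finset.sum_comm]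
    apply Finset.sum_congr rfl
    intro k _
    exact Finset.sum_congr rfl fun x _ => by ring
  have h2 : trace (gramM (fun x => Matrix.of fun i j => scon μ i j x) * E) =
      ∑ i, ∑ j, ∑ k, ∑ x, E k x * scon μ i j x * scon μ i j k := by
    rw [trace_mul_comm]
    simp only [trace, diag_apply, mul_apply, gramM, of_apply, Finset.mul_sum]
    have e1 : ∀ k : Fin m, ∑ x, ∑ i, ∑ j, E k x * (scon μ i j x * scon μ i j k) =
        ∑ i, ∑ j, ∑ x, E k x * scon μ i j x * scon μ i j k := by
      intro k
      rw [Finset.sum_comm]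
      apply Finset.sum_congr rfl
      intro i _
      rw [Finset.sum_comm]
      exact Finset.sum_congr rfl fun j _ => Finset.sum_congr rfl fun x _ => by ring
    simp only [e1]
    rw [Finset.sum_comm]
    apply Finset.sum_congr rfl
    intro i _
    rw [Finset.sum_comm]
  rw [RicM_eq, add_mul, trace_add, smul_mul_assoc, smul_mul_assoc, trace_smul, trace_smul, h1, h2]
  rfl

lemma swap_sum {m : ℕ} (μ : Bil m) (hμ : IsSkewBil μ) (E : Matrix (Fin m) (Fin m) ℝ) :
    (∑ i, ∑ j, ∑ k, ∑ x, E x j * scon μ i x k * scon μ i j k) =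
      ∑ i, ∑ j, ∑ k, ∑ x, E x i * scon μ x j k * scon μ i j k := by
  rw [Finset.sum_comm]
  refine Finset.sum_congr rfl fun i _ => Finset.sum_congr rfl fun j _ =>
    Finset.sum_congr rfl fun k _ => Finset.sum_congr rfl fun x _ => ?_
  rw [scon_skew μ hμ x j, scon_skew μ hμ i j]
  ring

lemma trace_Ric_diag {m : ℕ} (μ : Bil m) (hμ : IsSkewBil μ) (d : Fin m → ℝ) :
    trace (RicM μ * diagonal d) =
      (1/4) * ∑ i, ∑ j, ∑ k, (d k - d i - d j) * scon μ i j k ^ 2 := by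
  have h3 := swap_sum μ hμ (diagonal d)
  rw [trace_Ric_mul]
  have e1 : (∑ i, ∑ j, ∑ k, ∑ x, diagonal d x i * scon μ x j k * scon μ i j k) =
      ∑ i, ∑ j, ∑ k, d i * scon μ i j k ^ 2 := by
    refine Finset.sum_congr rfl fun i _ => Finset.sum_congr rfl fun j _ =>
      Finset.sum_congr rfl fun k _ => ?_
    rw [Finset.sum_eq_single i]
    · rw [diagonal_apply_eq]; ring
    · intro b _ hb; rw [diagonal_apply_ne _ hb]; ring
    · simp
  have e2 : (∑ i, ∑ j, ∑ k, ∑ x, diagonal d x j * scon μ i x k * scon μ i j k) =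
      ∑ i, ∑ j, ∑ k, d j * scon μ i j k ^ 2 := by
    refine Finset.sum_congr rfl fun i _ => Finset.sum_congr rfl fun j _ =>
      Finset.sum_congr rfl fun k _ => ?_
    rw [Finset.sum_eq_single j]
    · rw [diagonal_apply_eq]; ring
    · intro b _ hb; rw [diagonal_apply_ne _ hb]; ring
    · simp
  have e3 : (∑ i, ∑ j, ∑ k, ∑ x, diagonal d k x * scon μ i j x * scon μ i j k) =
      ∑ i, ∑ j, ∑ k, d k * scon μ i j k ^ 2 := by
    refine Finset.sum_congr rfl fun i _ => Finset.sum_congr rfl fun j _ =>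
      Finset.sum_congr rfl fun k _ => ?_
    rw [Finset.sum_eq_single k]
    · rw [diagonal_apply_eq]; ring
    · intro b _ hb; rw [diagonal_apply_ne' _ hb]; ring
    · simp
  have e4 : ∑ i, ∑ j, ∑ k, (d k - d i - d j) * scon μ i j k ^ 2 =
      (∑ i, ∑ j, ∑ k, d k * scon μ i j k ^ 2) - (∑ i, ∑ j, ∑ k, d i * scon μ i j k ^ 2) -
      (∑ i, ∑ j, ∑ k, d j * scon μ i j k ^ 2) := by
    simp only [sub_mul, Finset.sum_sub_distrib]
  rw [e1, e2] at h3
  rw [e1, e3, e4, h3]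
  ring

lemma trace_Ric {m : ℕ} (μ : Bil m) (hμ : IsSkewBil μ) :
    trace (RicM μ) = -(1/4) * normSqV μ := by
  have := trace_Ric_diag μ hμ (fun _ => 1)
  rw [diagonal_one, mul_one] at this
  rw [this, normSqV_eq]
  have e : ∀ i j k, ((1:ℝ) - 1 - 1) * scon μ i j k ^ 2 = (-1) * scon μ i j k ^ 2 := by
    intros; ring
  simp only [e, ← Finset.mul_sum]
  ring

lemma der_scon {m : ℕ} (μ : Bil m) (hμ : IsSkewBil μ) (E : Matrix (Fin m) (Fin m) ℝ)
    (hE : IsDerivation μ E) (i j k : Fin m) :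
    ∑ x, E k x * scon μ i j x = ∑ x, E x i * scon μ x j k + ∑ x, E x j * scon μ i x k := by
  have h := congrFun (hE (bvec m i) (bvec m j)) k
  have hb : ∀ (M : Matrix (Fin m) (Fin m) ℝ) (i x), M.mulVec (bvec m i) x = M x i := by
    intro M i x
    simp [bvec]
  rw [Pi.add_apply, bil_expand μ hμ, bil_expand μ hμ] at h
  have hd : ∀ i j, bvec m i j = if j = i then 1 else 0 := by
    intro i j
    rw [bvec, Pi.single_apply]
  simp only [hb] at h
  simp only [hd, mul_ite, ite_mul, mul_one, one_mul, mul_zero, zero_mul, Finset.sum_ite_eq',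
    Finset.sum_ite_irrel, Finset.sum_const_zero, Finset.mem_univ, if_true] at h
  exact h

lemma trace_Ric_der {m : ℕ} (μ : Bil m) (hμ : IsSkewBil μ) (E : Matrix (Fin m) (Fin m) ℝ)
    (hE : IsDerivation μ E) : trace (RicM μ * E) = 0 := by
  have h3 := swap_sum μ hμ E
  rw [trace_Ric_mul]
  have : (∑ i, ∑ j, ∑ k, ∑ x, E k x * scon μ i j x * scon μ i j k) =
      (∑ i, ∑ j, ∑ k, ∑ x, E x i * scon μ x j k * scon μ i j k) +
      ∑ i, ∑ j, ∑ k, ∑ x, E x j * scon μ i x k * scon μ i j k := by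
    simp only [← Finset.sum_add_distrib]
    refine Finset.sum_congr rfl fun i _ => Finset.sum_congr rfl fun j _ =>
      Finset.sum_congr rfl fun k _ => ?_
    have h := der_scon μ hμ E hE i j k
    rw [← Finset.sum_mul, h, add_mul, Finset.sum_mul, Finset.sum_mul, Finset.sum_add_distrib]
  rw [this, h3]
  ring

lemma Ricac_symm {m : ℕ} (J : Matrix (Fin m) (Fin m) ℝ) (hJt : Jᵀ = -J) (μ : Bil m) :
    (Ricac J μ)ᵀ = Ricac J μ := by
  simp only [Ricac, transpose_smul, transpose_add, transpose_mul, RicM_symm, hJt]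
  congr 2
  noncomm_ring

lemma Ricac_anti {m : ℕ} (J : Matrix (Fin m) (Fin m) ℝ) (hJ : J * J = -1) (μ : Bil m) :
    J * Ricac J μ * J = Ricac J μ := by
  simp only [Ricac, mul_smul_comm, smul_mul_assoc]
  congr 1
  calc J * (RicM μ + J * RicM μ * J) * J = J * RicM μ * J + (J * J) * RicM μ * (J * J) := by
        noncomm_ring
    _ = _ := by rw [hJ]; noncomm_ring

lemma trace_Ricac_mul {m : ℕ} (J : Matrix (Fin m) (Fin m) ℝ) (μ : Bil m)
    (A : Matrix (Fin m) (Fin m) ℝ) (hA : J * A * J = A) :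
    trace (Ricac J μ * A) = trace (RicM μ * A) := by
  have : trace (J * RicM μ * J * A) = trace (RicM μ * A) := by
    rw [mul_assoc, mul_assoc, trace_mul_comm]
    conv_rhs => rw [← hA]
    congr 1
    noncomm_ring
  rw [Ricac, smul_mul_assoc, trace_smul, add_mul, trace_add, this, smul_eq_mul]
  ring

lemma Ricac_mact {m : ℕ} (J J' k : Matrix (Fin m) (Fin m) ℝ) (hk : kᵀ * k = 1)
    (hJ : J' = k * J * kᵀ) (μ : Bil m) (hμ : IsSkewBil μ) :
    Ricac J' (mact k μ) = k * Ricac J μ * kᵀ := by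
  rw [Ricac, Ricac, RicM_mact k hk μ hμ, mul_smul_comm, smul_mul_assoc]
  congr 1
  have : J' * (k * RicM μ * kᵀ) * J' = k * J * (kᵀ * k) * RicM μ * (kᵀ * k) * J * kᵀ := by
    rw [hJ]; noncomm_ring
  rw [this, hk]
  noncomm_ring

lemma der_mact {m : ℕ} (g E : Matrix (Fin m) (Fin m) ℝ) (ug : IsUnit g) (μ : Bil m)
    (hE : IsDerivation μ E) : IsDerivation (mact g μ) (g * E * g⁻¹) := by
  intro X Y
  have h := congrArg g.mulVec (hE (g⁻¹.mulVec X) (g⁻¹.mulVec Y))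
  simp only [mact, mulVec_mulVec, ← mul_assoc, inv_mul_u ug, one_mul]
  rw [mulVec_mulVec, mulVec_add, mulVec_mulVec, mulVec_mulVec] at h
  rw [mul_assoc, inv_mul_u ug, mul_one]
  exact h

/-- the criticality condition. -/
def Crit {m : ℕ} (J : Matrix (Fin m) (Fin m) ℝ) (μ : Bil m) (c : ℝ) : Prop :=
  IsDerivation μ (Ricac J μ - c • (1 : Matrix (Fin m) (Fin m) ℝ))

lemma crit_mact {m : ℕ} (J J' k : Matrix (Fin m) (Fin m) ℝ) (hk : kᵀ * k = 1)
    (hJ : J' = k * J * kᵀ) (μ : Bil m) (hμ : IsSkewBil μ) (c : ℝ) (hc : Crit J μ c) :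
    Crit J' (mact k μ) c := by
  have hk' : k * kᵀ = 1 := mul_eq_one_comm.1 hk
  have := der_mact k _ (unit_of_left hk') μ hc
  rw [inv_orth hk] at this
  rw [Crit, Ricac_mact J J' k hk hJ μ hμ]
  convert this using 1
  rw [mul_sub, sub_mul, mul_smul_comm, smul_mul_assoc, mul_one, hk']

lemma crit_trace {m : ℕ} (J : Matrix (Fin m) (Fin m) ℝ) (hJ : J * J = -1) (μ : Bil m)
    (hμ : IsSkewBil μ) (c : ℝ) (hc : Crit J μ c) :
    trace (Ricac J μ * Ricac J μ) = -c / 4 * normSqV μ := by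
  rw [trace_Ricac_mul J μ _ (Ricac_anti J hJ μ)]
  have h := trace_Ric_der μ hμ _ hc
  rw [mul_sub, trace_sub, mul_smul_comm, mul_one, trace_smul, trace_Ric μ hμ, smul_eq_mul] at h
  linarith

lemma scon_diag {m : ℕ} (δ : Fin m → ℝ) (μ : Bil m) (hμ : IsSkewBil μ) (i j k : Fin m) :
    scon (mact (diagonal (fun i => Real.exp (δ i))) μ) i j k =
      Real.exp (δ k - δ i - δ j) * scon μ i j k := by
  have hinv : (diagonal (fun i => Real.exp (δ i)))⁻¹ = diagonal (fun i => Real.exp (-δ i)) := by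
    apply inv_eq_left_inv
    rw [diagonal_mul_diagonal]
    have : (fun i => Real.exp (-δ i) * Real.exp (δ i)) = fun _ => 1 := by
      funext i
      rw [← Real.exp_add]
      simp
    rw [this, diagonal_one]
  rw [scon_mact _ μ hμ, hinv]
  rw [Finset.sum_eq_single k, Finset.sum_eq_single i, Finset.sum_eq_single j]
  · simp only [diagonal_apply_eq]
    rw [sub_eq_add_neg, sub_eq_add_neg, Real.exp_add, Real.exp_add]
    ring
  · intro y _ hy
    rw [diagonal_apply_ne _ hy]
    ring
  · simp
  · intro x _ hx
    apply Finset.sum_eq_zero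
    intro y _
    rw [diagonal_apply_ne _ hx]
    ring
  · simp
  · intro l _ hl
    refine Finset.sum_eq_zero fun x _ => Finset.sum_eq_zero fun y _ => ?_
    rw [diagonal_apply_ne' _ hl]
    ring
  · simp

lemma chebyshev_aux {ι : Type*} [Fintype ι] (a w : ι → ℝ) (hw : ∀ x, 0 ≤ w x)
    (h : (∑ x, w x) * (∑ x, a x * (Real.exp (a x) ^ 2 * w x)) =
      (∑ x, Real.exp (a x) ^ 2 * w x) * ∑ x, a x * w x) :
    ∀ x y, w x ≠ 0 → w y ≠ 0 → a x = a y := by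
  have key : ∑ x, ∑ y, (a x - a y) * (Real.exp (a x) ^ 2 - Real.exp (a y) ^ 2) * (w x * w y) = 0 := by
    have e : ∀ x y, (a x - a y) * (Real.exp (a x) ^ 2 - Real.exp (a y) ^ 2) * (w x * w y) =
        (a x * (Real.exp (a x) ^ 2 * w x)) * w y + w x * (a y * (Real.exp (a y) ^ 2 * w y))
        - (Real.exp (a x) ^ 2 * w x) * (a y * w y) - (a x * w x) * (Real.exp (a y) ^ 2 * w y) := by
      intros; ring
    simp only [e, Finset.sum_sub_distrib, Finset.sum_add_distrib, ← Finset.mul_sum,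
      ← Finset.sum_mul]
    linarith
  have mono : ∀ s t : ℝ, s < t → Real.exp s ^ 2 < Real.exp t ^ 2 := by
    intro s t h
    have := Real.exp_lt_exp.2 h
    have := Real.exp_pos s
    gcongr
  have hnn : ∀ x y, 0 ≤ (a x - a y) * (Real.exp (a x) ^ 2 - Real.exp (a y) ^ 2) := by
    intro x y
    rcases lt_trichotomy (a x) (a y) with h | h | h
    · have := mono _ _ h
      nlinarith
    · rw [h]; simp
    · have := mono _ _ h
      nlinarith
  have hnn2 : ∀ x y, 0 ≤ (a x - a y) * (Real.exp (a x) ^ 2 - Real.exp (a y) ^ 2) * (w x * w y) :=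
    fun x y => mul_nonneg (hnn x y) (mul_nonneg (hw x) (hw y))
  intro x y hx hy
  rw [Finset.sum_eq_zero_iff_of_nonneg (fun x _ => Finset.sum_nonneg fun y _ => hnn2 x y)] at key
  have k1 := key x (Finset.mem_univ _)
  rw [Finset.sum_eq_zero_iff_of_nonneg (fun y _ => hnn2 x y)] at k1
  have k2 := k1 y (Finset.mem_univ _)
  by_contra hne
  rcases mul_eq_zero.1 k2 with h | h
  · rcases mul_eq_zero.1 h with h | h
    · exact hne (by linarith)
    · rcases lt_or_gt_of_ne hne with h' | h'
      · have := mono _ _ h'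
        linarith
      · have := mono _ _ h'
        linarith
  · exact mul_ne_zero hx hy h

lemma sum3 {m : ℕ} (f : Fin m → Fin m → Fin m → ℝ) :
    ∑ i, ∑ j, ∑ k, f i j k = ∑ x : Fin m × Fin m × Fin m, f x.1 x.2.1 x.2.2 := by
  rw [Fintype.sum_prod_type]
  apply Finset.sum_congr rfl
  intro i _
  rw [Fintype.sum_prod_type]

lemma final_step {m : ℕ} (J : Matrix (Fin m) (Fin m) ℝ)
    (μ : Bil m) (hμ : IsSkewBil μ) (P Q : Matrix (Fin m) (Fin m) ℝ) (δ : Fin m → ℝ)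
    (hJ : J * J = -1)
    (hQ : Qᵀ * Q = 1) (hP : P = Q * diagonal (fun i => Real.exp (δ i)) * Qᵀ) (hPJ : P * J * P = J)
    (h : normSqV μ • Ricac J (mact P μ) = normSqV (mact P μ) • Ricac J μ) :
    ∃ t : ℝ, t ≠ 0 ∧ mact P μ = t • μ := by
  have hQ' : Q * Qᵀ = 1 := mul_eq_one_comm.1 hQ
  have hQt : (Qᵀ)ᵀ * Qᵀ = 1 := by rw [transpose_transpose, hQ']
  have hδ : ∀ i j, (δ i + δ j) * (Qᵀ * J * Q) i j = 0 := by
    intro i j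
    have h1 := hPJ
    rw [hP, diag_conj Q hQ] at h1
    have h2 := h1 i j
    rcases exp_root_aux (δ i / 2) (δ j / 2) ((Qᵀ * J * Q) i j) (by
      rw [mul_div_cancel₀ _ two_ne_zero, mul_div_cancel₀ _ two_ne_zero]; exact h2) with h | h
    · rw [h, mul_zero]
    · rw [show δ i + δ j = 0 by linarith, zero_mul]
  set A := Q * diagonal δ * Qᵀ with hA
  have hAJ : A * J = - (J * A) := by
    have h1 : diagonal δ * (Qᵀ * J * Q) = - ((Qᵀ * J * Q) * diagonal δ) := by
      ext i j
      rw [neg_apply, diagonal_mul, mul_diagonal]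
      linarith [hδ i j]
    calc A * J = Q * diagonal δ * Qᵀ * J * (Q * Qᵀ) := by rw [hQ', mul_one]
      _ = Q * (diagonal δ * (Qᵀ * J * Q)) * Qᵀ := by noncomm_ring
      _ = - ((Q * Qᵀ) * J * Q * diagonal δ * Qᵀ) := by rw [h1]; noncomm_ring
      _ = - (J * A) := by rw [hQ', hA]; noncomm_ring
  have hJAJ : J * A * J = A := by
    rw [mul_assoc, hAJ, mul_neg, ← mul_assoc, hJ]; simp
  set ρ := mact Qᵀ μ with hρ
  have hρs : IsSkewBil ρ := mact_skew _ _ hμ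
  have hT : ∀ ν : Bil m, IsSkewBil ν → trace (Ricac J ν * A) =
      (1/4) * ∑ i, ∑ j, ∑ k, (δ k - δ i - δ j) * scon (mact Qᵀ ν) i j k ^ 2 := by
    intro ν hν
    rw [trace_Ricac_mul J ν A hJAJ, ← trace_Ric_diag _ (mact_skew _ _ hν), RicM_mact _ hQt ν hν,
      transpose_transpose, hA, ← mul_assoc, trace_mul_comm, ← mul_assoc, ← mul_assoc]
  have hPQ : mact Qᵀ (mact P μ) = mact (diagonal (fun i => Real.exp (δ i))) ρ := by
    rw [hρ, mact_mact, mact_mact, hP, ← mul_assoc, ← mul_assoc, hQ, one_mul]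
  have hPμ : IsSkewBil (mact P μ) := mact_skew _ _ hμ
  have h1 := congrArg (fun X => trace (X * A)) h
  simp only [smul_mul_assoc, trace_smul, hT μ hμ, hT _ hPμ, smul_eq_mul] at h1
  rw [← normSqV_mact Qᵀ hQt μ hμ, ← normSqV_mact Qᵀ hQt _ hPμ, hPQ, ← hρ, normSqV_eq,
    normSqV_eq] at h1
  simp only [scon_diag δ ρ hρs, mul_pow] at h1
  rw [sum3, sum3, sum3, sum3] at h1
  have h2 := chebyshev_aux (fun x : Fin m × Fin m × Fin m => δ x.2.2 - δ x.1 - δ x.2.1)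
    (fun x => scon ρ x.1 x.2.1 x.2.2 ^ 2) (fun x => sq_nonneg _) (by linarith)
  have h3 : ∃ t : ℝ, t ≠ 0 ∧ mact (diagonal (fun i => Real.exp (δ i))) ρ = t • ρ := by
    by_cases hz : ∃ x : Fin m × Fin m × Fin m, scon ρ x.1 x.2.1 x.2.2 ≠ 0
    · obtain ⟨x, hx⟩ := hz
      refine ⟨Real.exp (δ x.2.2 - δ x.1 - δ x.2.1), (Real.exp_pos _).ne', ?_⟩
      apply bil_ext _ _ (mact_skew _ _ hρs) (smul_skew _ _ hρs)
      intro i j k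
      rw [scon_diag δ ρ hρs]
      change _ = Real.exp (δ x.2.2 - δ x.1 - δ x.2.1) * scon ρ i j k
      by_cases h0 : scon ρ i j k = 0
      · rw [h0, mul_zero, mul_zero]
      · have := h2 (i, j, k) x (pow_ne_zero 2 h0) (pow_ne_zero 2 hx)
        simp only at this
        rw [this]
    · push Not at hz
      refine ⟨1, one_ne_zero, ?_⟩
      apply bil_ext _ _ (mact_skew _ _ hρs) (smul_skew _ _ hρs)
      intro i j k
      rw [scon_diag δ ρ hρs, hz (i, j, k), mul_zero]
      change _ = 1 * scon ρ i j k
      rw [hz (i, j, k), mul_zero]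
  obtain ⟨t, ht, h4⟩ := h3
  refine ⟨t, ht, ?_⟩
  rw [← hPQ] at h4
  have h5 := congrArg (mact Q) h4
  rwa [mact_smul, hρ, mact_mact, mact_mact, mact_mact, hQ', one_mul, mact_one] at h5

lemma weight_aux {m : ℕ} (b : Fin m → ℝ) (c : ℝ) (p P : Matrix (Fin m) (Fin m) ℝ) (μ : Bil m)
    (hμ : IsSkewBil μ) (hp : p.BlockTriangular (fun i => -b i))
    (hpi : p⁻¹.BlockTriangular (fun i => -b i))
    (hP : dz (fun i => -b i) p = P) (hPi : dz (fun i => -b i) p⁻¹ = P⁻¹)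
    (hw : ∀ i j k, (b k - b i - b j + c) * scon μ i j k = 0) (i j k : Fin m) :
    0 ≤ (b k - b i - b j + c) * scon (mact p μ) i j k ^ 2 ∧
    (b k - b i - b j + c = 0 → scon (mact p μ) i j k = scon (mact P μ) i j k) ∧
    (b k - b i - b j + c ≠ 0 → scon (mact P μ) i j k = 0) := by
  have hp' : ∀ x y, p x y ≠ 0 → b y ≤ b x := by
    intro x y h
    by_contra hc
    exact h (hp (by simpa using hc))
  have hpi' : ∀ x y, p⁻¹ x y ≠ 0 → b y ≤ b x := by
    intro x y h
    by_contra hc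
    exact h (hpi (by simpa using hc))
  have hPa : ∀ x y, P x y = if b x = b y then p x y else 0 := by
    intro x y
    rw [← hP, dz_apply]
    simp only [neg_inj]
  have hPia : ∀ x y, P⁻¹ x y = if b x = b y then p⁻¹ x y else 0 := by
    intro x y
    rw [← hPi, dz_apply]
    simp only [neg_inj]
  have hw' : ∀ i j k, scon μ i j k ≠ 0 → b k - b i - b j + c = 0 := by
    intro i j k h
    exact (mul_eq_zero.1 (hw i j k)).resolve_right h
  refine ⟨?_, ?_, ?_⟩
  · by_cases h0 : 0 ≤ b k - b i - b j + c
    · exact mul_nonneg h0 (sq_nonneg _)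
    · have : scon (mact p μ) i j k = 0 := by
        rw [scon_mact p μ hμ]
        refine Finset.sum_eq_zero fun l _ => Finset.sum_eq_zero fun x _ =>
          Finset.sum_eq_zero fun y _ => ?_
        by_contra hne
        simp only [mul_eq_zero, not_or] at hne
        obtain ⟨h1, ⟨h2, h3⟩, h4⟩ := hne
        have := hp' _ _ h1
        have := hpi' _ _ h2
        have := hpi' _ _ h3
        have := hw' _ _ _ h4
        apply h0
        linarith
      rw [this]; simp
  · intro h0
    rw [scon_mact p μ hμ, scon_mact P μ hμ]
    refine Finset.sum_congr rfl fun l _ => Finset.sum_congr rfl fun x _ =>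
          Finset.sum_congr rfl fun y _ => ?_
    rw [hPa, hPia, hPia]
    by_cases hne : p k l * (p⁻¹ x i * p⁻¹ y j * scon μ x y l) = 0
    · rw [hne]
      split_ifs <;> simp
      simpa using hne
    · simp only [mul_eq_zero, not_or] at hne
      obtain ⟨h1, ⟨h2, h3⟩, h4⟩ := hne
      have e1 := hp' _ _ h1
      have e2 := hpi' _ _ h2
      have e3 := hpi' _ _ h3
      have e4 := hw' _ _ _ h4
      rw [if_pos (by linarith), if_pos (by linarith), if_pos (by linarith)]
  · intro h0
    rw [scon_mact P μ hμ]
    refine Finset.sum_eq_zero fun l _ => Finset.sum_eq_zero fun x _ =>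
      Finset.sum_eq_zero fun y _ => ?_
    by_contra hne
    simp only [mul_eq_zero, not_or] at hne
    obtain ⟨h1, ⟨h2, h3⟩, h4⟩ := hne
    rw [hPa] at h1
    rw [hPia] at h2 h3
    have e1 : b k = b l := by by_contra h; simp [h] at h1
    have e2 : b x = b i := by by_contra h; simp [h] at h2
    have e3 : b y = b j := by by_contra h; simp [h] at h3
    have e4 := hw' _ _ _ h4
    apply h0
    linarith

lemma symm_zero {m : ℕ} (A : Matrix (Fin m) (Fin m) ℝ) (hA : Aᵀ = A) (h : trace (A * A) ≤ 0) :
    A = 0 := by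
  have h1 : trace (A * A) = ∑ i, ∑ j, A i j ^ 2 := by
    simp only [trace, diag_apply, mul_apply]
    refine Finset.sum_congr rfl fun i _ => Finset.sum_congr rfl fun j _ => ?_
    have := congrFun (congrFun hA i) j
    rw [transpose_apply] at this
    rw [this, pow_two]
  rw [h1] at h
  have h2 : ∑ i, ∑ j, A i j ^ 2 = 0 :=
    le_antisymm h (Finset.sum_nonneg fun i _ => Finset.sum_nonneg fun j _ => sq_nonneg _)
  ext i j
  have h3 := (Finset.sum_eq_zero_iff_of_nonneg
    (fun i _ => Finset.sum_nonneg fun j _ => sq_nonneg (A i j))).1 h2 i (Finset.mem_univ _)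
  have h4 := (Finset.sum_eq_zero_iff_of_nonneg (fun j _ => sq_nonneg (A i j))).1 h3 j
    (Finset.mem_univ _)
  simpa using h4

lemma core {m : ℕ} (J : Matrix (Fin m) (Fin m) ℝ) (hJt : Jᵀ = -J) (hJ : J * J = -1)
    (μ : Bil m) (hμ : IsSkewBil μ) (h0 : μ ≠ 0) (g : Matrix (Fin m) (Fin m) ℝ)
    (hg : gᵀ * J * g = J) (b : Fin m → ℝ) (hb : Ricac J μ = diagonal b) (c c' : ℝ)
    (hc : Crit J μ c) (hc' : Crit J (mact g μ) c')
    (hineq : -c' * normSqV μ ≤ -c * normSqV (mact g μ)) :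
    ∃ (k : Matrix (Fin m) (Fin m) ℝ) (t : ℝ), t ≠ 0 ∧ kᵀ * J * k = J ∧ kᵀ * k = 1 ∧
      mact g μ = t • mact k μ := by
  have hanti := Ricac_anti J hJ μ
  have hJa : ∀ i j, J i j ≠ 0 → -b i + -b j = 0 := by
    intro i j hij
    have h1 : J * diagonal b = - (diagonal b * J) := by
      rw [hb] at hanti
      calc J * diagonal b = -(J * diagonal b * (J * J)) := by rw [hJ]; simp
        _ = -((J * diagonal b * J) * J) := by simp only [mul_assoc]
        _ = _ := by rw [hanti]
    have h2 := congrFun (congrFun h1 i) j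
    rw [mul_diagonal, neg_apply, diagonal_mul] at h2
    have : (b i + b j) * J i j = 0 := by linarith
    have := (mul_eq_zero.1 this).resolve_right hij
    linarith
  obtain ⟨p, P, Q, δ, hpg, hpJ, hpB, hP, hPi, hPQ, hQ, hPJ⟩ :=
    decomp (fun i => -b i) J g hJt hJ hJa hg
  have up : IsUnit p := by
    apply unit_of_right (M := -(J * pᵀ * J))
    calc -(J * pᵀ * J) * p = -(J * (pᵀ * J * p)) := by noncomm_ring
      _ = 1 := by rw [hpJ, hJ, neg_neg]
  have hpp := mul_inv_u up
  have hpp' : (p⁻¹)ᵀ * pᵀ = 1 := by rw [← transpose_mul, hpp, transpose_one]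
  set k := g * p⁻¹ with hkdef
  have hk : kᵀ * k = 1 := by
    calc kᵀ * k = (p⁻¹)ᵀ * (gᵀ * g) * p⁻¹ := by rw [hkdef, transpose_mul]; noncomm_ring
      _ = ((p⁻¹)ᵀ * pᵀ) * (p * p⁻¹) := by rw [← hpg]; noncomm_ring
      _ = 1 := by rw [hpp, hpp', one_mul]
  have hkJ : kᵀ * J * k = J := by
    calc kᵀ * J * k = (p⁻¹)ᵀ * (gᵀ * J * g) * p⁻¹ := by rw [hkdef, transpose_mul]; noncomm_ring
      _ = (p⁻¹)ᵀ * (pᵀ * J * p) * p⁻¹ := by rw [hg, hpJ]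
      _ = ((p⁻¹)ᵀ * pᵀ) * J * (p * p⁻¹) := by noncomm_ring
      _ = J := by rw [hpp, hpp', one_mul, mul_one]
  have hkp : k * p = g := by rw [hkdef, mul_assoc, inv_mul_u up, mul_one]
  have hk' : k * kᵀ = 1 := mul_eq_one_comm.1 hk
  set ν := mact p μ with hν
  have hνs : IsSkewBil ν := mact_skew _ _ hμ
  have hgν : mact g μ = mact k ν := by rw [hν, mact_mact, hkp]
  have hνg : ν = mact kᵀ (mact g μ) := by rw [hgν, mact_mact, hk, mact_one]
  have hcν : Crit J ν c' := by
    rw [hνg]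
    apply crit_mact J J kᵀ _ _ _ (mact_skew _ _ hμ) c' hc'
    · rw [transpose_transpose, hk']
    · rw [transpose_transpose, hkJ]
  have hs : normSqV (mact g μ) = normSqV ν := by rw [hgν, normSqV_mact k hk ν hνs]
  rw [hs] at hineq
  have hr := normSqV_pos μ hμ h0
  have hw : ∀ i j k, (b k - b i - b j + c) * scon μ i j k = 0 := by
    intro i j k
    have h := der_scon μ hμ _ hc i j k
    have hE : Ricac J μ - c • (1 : Matrix (Fin m) (Fin m) ℝ) = diagonal (fun i => b i - c) := by
      rw [hb]
      ext x y
      by_cases hxy : x = y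
      · subst hxy; simp
      · simp [hxy]
    rw [hE] at h
    simp only [diagonal_apply, ite_mul, zero_mul, Finset.sum_ite_eq, Finset.sum_ite_eq',
      Finset.mem_univ, if_true] at h
    linear_combination h
  have hwt := weight_aux b c p P μ hμ hpB (bt_inv _ p up hpB) hP hPi hw
  have t1 := crit_trace J hJ μ hμ c hc
  have t2 := crit_trace J hJ ν hνs c' hcν
  have t3 : trace (Ricac J ν * Ricac J μ) =
      (1/4) * ∑ i, ∑ j, ∑ k, (b k - b i - b j + c) * scon ν i j k ^ 2 - c / 4 * normSqV ν := by
    rw [trace_Ricac_mul J ν _ hanti, hb, trace_Ric_diag ν hνs, normSqV_eq]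
    simp only [add_mul, Finset.sum_add_distrib, ← Finset.mul_sum]
    ring
  have hnn : ∀ i j, 0 ≤ ∑ k, (b k - b i - b j + c) * scon ν i j k ^ 2 :=
    fun i j => Finset.sum_nonneg fun k _ => (hwt i j k).1
  have hnn' : ∀ i, 0 ≤ ∑ j, ∑ k, (b k - b i - b j + c) * scon ν i j k ^ 2 :=
    fun i => Finset.sum_nonneg fun j _ => hnn i j
  have hS : 0 ≤ ∑ i, ∑ j, ∑ k, (b k - b i - b j + c) * scon ν i j k ^ 2 :=
    Finset.sum_nonneg fun i _ => hnn' i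
  set S := ∑ i, ∑ j, ∑ k, (b k - b i - b j + c) * scon ν i j k ^ 2 with hSdef
  set r := normSqV μ with hrdef
  set s := normSqV ν with hsdef
  have hs0 : 0 ≤ s := by
    rw [hsdef, normSqV_eq]
    exact Finset.sum_nonneg fun i _ => Finset.sum_nonneg fun j _ =>
      Finset.sum_nonneg fun k _ => sq_nonneg _
  have hspos : 0 < s := by
    rw [hsdef]
    apply normSqV_pos ν hνs
    intro hz
    apply h0
    have : mact p⁻¹ ν = μ := by rw [hν, mact_mact, inv_mul_u up, mact_one]
    rw [← this, hz]
    funext x y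
    simp [mact]
  set β := Ricac J μ with hβ
  set β' := Ricac J ν with hβ'
  have t4 : trace ((r • β' - s • β) * (r • β' - s • β)) =
      r ^ 2 * trace (β' * β') - 2 * r * s * trace (β' * β) + s ^ 2 * trace (β * β) := by
    have hcm : trace (β * β') = trace (β' * β) := trace_mul_comm _ _
    simp only [sub_mul, mul_sub, trace_sub, smul_mul_assoc, mul_smul_comm, trace_smul,
      smul_eq_mul, hcm]
    ring
  rw [t1, t2, t3] at t4
  have t5 : trace ((r • β' - s • β) * (r • β' - s • β)) =
      r * s / 4 * (-c' * r - -c * s) - r * s / 2 * S := by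
    rw [t4]; ring
  have hrs : 0 < r * s := mul_pos hr hspos
  have t6 : r * s / 4 * (-c' * r - -c * s) ≤ 0 :=
    mul_nonpos_of_nonneg_of_nonpos (by positivity) (by linarith)
  have t7 : 0 ≤ r * s / 2 * S := mul_nonneg (by positivity) hS
  have hz : r • β' - s • β = 0 := by
    apply symm_zero
    · rw [transpose_sub, transpose_smul, transpose_smul, Ricac_symm J hJt, Ricac_symm J hJt]
    · rw [t5]; linarith
  have hS0 : S = 0 := by
    rw [hz, mul_zero, trace_zero] at t5
    have : r * s / 2 * S = 0 := by linarith
    exact (mul_eq_zero.1 this).resolve_left (by positivity)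
  have hνP : ν = mact P μ := by
    apply bil_ext _ _ hνs (mact_skew _ _ hμ)
    intro i j k
    have q1 := (Finset.sum_eq_zero_iff_of_nonneg (fun i _ => hnn' i)).1 hS0 i (Finset.mem_univ _)
    have q2 := (Finset.sum_eq_zero_iff_of_nonneg (fun j _ => hnn i j)).1 q1 j (Finset.mem_univ _)
    have q3 := (Finset.sum_eq_zero_iff_of_nonneg (fun k _ => (hwt i j k).1)).1 q2 k
      (Finset.mem_univ _)
    obtain ⟨-, w1, w2⟩ := hwt i j k
    by_cases hww : b k - b i - b j + c = 0
    · exact w1 hww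
    · rw [w2 hww]
      simpa using (mul_eq_zero.1 q3).resolve_left hww
  obtain ⟨t, ht, hfin⟩ := final_step J μ hμ P Q δ hJ hQ hPQ hPJ (by
    rw [← hνP]
    exact sub_eq_zero.1 hz)
  refine ⟨k, t, ht, hkJ, hk, ?_⟩
  rw [hgν, hνP, hfin, mact_smul]

lemma core2 {m : ℕ} (J : Matrix (Fin m) (Fin m) ℝ) (hJt : Jᵀ = -J) (hJ : J * J = -1)
    (μ : Bil m) (hμ : IsSkewBil μ) (h0 : μ ≠ 0) (g : Matrix (Fin m) (Fin m) ℝ)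
    (hg : gᵀ * J * g = J) (c c' : ℝ)
    (hc : Crit J μ c) (hc' : Crit J (mact g μ) c')
    (hineq : -c' * normSqV μ ≤ -c * normSqV (mact g μ)) :
    ∃ (k : Matrix (Fin m) (Fin m) ℝ) (t : ℝ), t ≠ 0 ∧ kᵀ * J * k = J ∧ kᵀ * k = 1 ∧
      mact g μ = t • mact k μ := by
  obtain ⟨Q, b, hQ, hQb⟩ := spec_exists (Ricac J μ) (Ricac_symm J hJt μ)
  have hQ' : Q * Qᵀ = 1 := mul_eq_one_comm.1 hQ
  have hQt : (Qᵀ)ᵀ * Qᵀ = 1 := by rw [transpose_transpose, hQ']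
  have hJJ : Qᵀ * J * Q = Qᵀ * J * (Qᵀ)ᵀ := by rw [transpose_transpose]
  have hgs := mact_skew g μ hμ
  have hgg : mact (Qᵀ * g * Q) (mact Qᵀ μ) = mact Qᵀ (mact g μ) := by
    rw [mact_mact, mact_mact, mul_assoc, hQ', mul_one]
  obtain ⟨k, t, ht, hkJ, hk, hfin⟩ := core (Qᵀ * J * Q)
    (by rw [transpose_mul, transpose_mul, transpose_transpose, hJt]; noncomm_ring)
    (by
      calc Qᵀ * J * Q * (Qᵀ * J * Q) = Qᵀ * J * (Q * Qᵀ) * J * Q := by noncomm_ring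
        _ = Qᵀ * (J * J) * Q := by rw [hQ']; noncomm_ring
        _ = -(Qᵀ * Q) := by rw [hJ]; noncomm_ring
        _ = -1 := by rw [hQ])
    (mact Qᵀ μ) (mact_skew _ _ hμ)
    (by
      intro hz
      apply h0
      have : mact Q (mact Qᵀ μ) = μ := by rw [mact_mact, hQ', mact_one]
      rw [← this, hz]
      funext x y
      simp [mact])
    (Qᵀ * g * Q)
    (by
      rw [transpose_mul, transpose_mul, transpose_transpose]
      calc Qᵀ * (gᵀ * Q) * (Qᵀ * J * Q) * (Qᵀ * g * Q)
          = Qᵀ * gᵀ * (Q * Qᵀ) * J * (Q * Qᵀ) * g * Q := by noncomm_ring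
        _ = Qᵀ * (gᵀ * J * g) * Q := by rw [hQ']; noncomm_ring
        _ = _ := by rw [hg])
    b
    (by
      rw [Ricac_mact J _ Qᵀ hQt hJJ μ hμ, hQb, transpose_transpose]
      calc Qᵀ * (Q * diagonal b * Qᵀ) * Q = (Qᵀ * Q) * diagonal b * (Qᵀ * Q) := by noncomm_ring
        _ = _ := by rw [hQ, one_mul, mul_one])
    c c' (crit_mact J _ Qᵀ hQt hJJ μ hμ c hc)
    (by rw [hgg]; exact crit_mact J _ Qᵀ hQt hJJ _ hgs c' hc')
    (by rwa [hgg, normSqV_mact Qᵀ hQt _ hgs, normSqV_mact Qᵀ hQt _ hμ])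
  refine ⟨Q * k * Qᵀ, t, ht, ?_, ?_, ?_⟩
  · calc (Q * k * Qᵀ)ᵀ * J * (Q * k * Qᵀ) = Q * (kᵀ * (Qᵀ * J * Q) * k) * Qᵀ := by
          rw [transpose_mul, transpose_mul, transpose_transpose]; noncomm_ring
      _ = (Q * Qᵀ) * J * (Q * Qᵀ) := by rw [hkJ]; noncomm_ring
      _ = J := by rw [hQ', one_mul, mul_one]
  · calc (Q * k * Qᵀ)ᵀ * (Q * k * Qᵀ) = Q * (kᵀ * (Qᵀ * Q) * k) * Qᵀ := by
          rw [transpose_mul, transpose_mul, transpose_transpose]; noncomm_ring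
      _ = 1 := by rw [hQ, mul_one, hk, mul_one, hQ']
  · rw [hgg] at hfin
    have h5 := congrArg (mact Q) hfin
    rw [mact_smul, mact_mact, mact_mact, mact_mact, mact_mact, hQ', one_mul] at h5
    exact h5

lemma core3 {m : ℕ} (J : Matrix (Fin m) (Fin m) ℝ) (hJt : Jᵀ = -J) (hJ : J * J = -1)
    (μ : Bil m) (hμ : IsSkewBil μ) (h0 : μ ≠ 0) (g : Matrix (Fin m) (Fin m) ℝ)
    (hg : gᵀ * J * g = J) (c c' : ℝ)
    (hc : Crit J μ c) (hc' : Crit J (mact g μ) c') :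
    ∃ (k : Matrix (Fin m) (Fin m) ℝ) (t : ℝ), t ≠ 0 ∧ kᵀ * J * k = J ∧ kᵀ * k = 1 ∧
      mact g μ = t • mact k μ := by
  rcases le_total (-c' * normSqV μ) (-c * normSqV (mact g μ)) with h | h
  · exact core2 J hJt hJ μ hμ h0 g hg c c' hc hc' h
  · have ug : IsUnit g := by
      apply unit_of_right (M := -(J * gᵀ * J))
      calc -(J * gᵀ * J) * g = -(J * (gᵀ * J * g)) := by noncomm_ring
        _ = 1 := by rw [hg, hJ, neg_neg]
    have hgg : mact g⁻¹ (mact g μ) = μ := by rw [mact_mact, inv_mul_u ug, mact_one]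
    have hgi := mul_inv_u ug
    have hgt : (g⁻¹)ᵀ * gᵀ = 1 := by rw [← transpose_mul, hgi, transpose_one]
    obtain ⟨k, t, ht, hkJ, hk, hfin⟩ := core2 J hJt hJ (mact g μ) (mact_skew _ _ hμ)
      (by
        intro hz
        apply h0
        rw [← hgg, hz]
        funext x y
        simp [mact])
      g⁻¹
      (by
        calc (g⁻¹)ᵀ * J * g⁻¹ = (g⁻¹)ᵀ * (gᵀ * J * g) * g⁻¹ := by rw [hg]
          _ = ((g⁻¹)ᵀ * gᵀ) * J * (g * g⁻¹) := by noncomm_ring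
          _ = J := by rw [hgi, hgt, one_mul, mul_one])
      c' c hc' (by rwa [hgg]) (by rwa [hgg])
    have hk' : k * kᵀ = 1 := mul_eq_one_comm.1 hk
    rw [hgg] at hfin
    refine ⟨kᵀ, t⁻¹, inv_ne_zero ht, ?_, ?_, ?_⟩
    · rw [transpose_transpose]
      calc k * J * kᵀ = k * (kᵀ * J * k) * kᵀ := by rw [hkJ]
        _ = (k * kᵀ) * J * (k * kᵀ) := by noncomm_ring
        _ = J := by rw [hk', one_mul, mul_one]
    · rw [transpose_transpose, hk']
    · have h5 := congrArg (mact kᵀ) hfin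
      rw [mact_smul, mact_mact kᵀ k, hk, mact_one] at h5
      rw [h5, smul_smul, inv_mul_cancel₀ ht, one_smul]

lemma sympForm_mul {m : ℕ} (J g : Matrix (Fin m) (Fin m) ℝ) (X Y : Vec m) :
    sympForm J (g.mulVec X) (g.mulVec Y) = sympForm (gᵀ * J * g) X Y := by
  simp only [sympForm]
  rw [← mulVec_mulVec, ← mulVec_mulVec, dotProduct_mulVec X, vecMul_transpose]

/-- a minimal compatible metric on an (almost-)symplectic nilpotent Lie group is
unique up to isometry and scaling: if both `μ` and `g.μ` satisfy `Ric^{ac} = cI + D`, then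
`g.μ = t·(k.μ)` for some `k ∈ U(n)` and `t ≠ 0`. -/
theorem minimal_unique_symplectic (n : ℕ) (hn : 1 ≤ n)
    (J : Matrix (Fin (2 * n)) (Fin (2 * n)) ℝ) (hJskew : Jᵀ = -J) (hJsq : J * J = -1)
    (μ : Bil (2 * n)) (hμ : NilBracket μ) (hμ0 : μ ≠ 0)
    (g : Matrix (Fin (2 * n)) (Fin (2 * n)) ℝ) (hg : IsSymplMat J g)
    (c : ℝ) (D : Matrix (Fin (2 * n)) (Fin (2 * n)) ℝ) (hD : IsDerivation μ D)
    (hmin : Ricac J μ = c • (1 : Matrix (Fin (2 * n)) (Fin (2 * n)) ℝ) + D)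
    (c' : ℝ) (D' : Matrix (Fin (2 * n)) (Fin (2 * n)) ℝ) (hD' : IsDerivation (mact g μ) D')
    (hmin' : Ricac J (mact g μ) = c' • (1 : Matrix (Fin (2 * n)) (Fin (2 * n)) ℝ) + D') :
    ∃ (k : Matrix (Fin (2 * n)) (Fin (2 * n)) ℝ) (t : ℝ), t ≠ 0 ∧
      IsSymplMat J k ∧ kᵀ * k = 1 ∧ mact g μ = t • mact k μ := by
  have hgJ : gᵀ * J * g = J := by
    ext i j
    have h := hg.2 (Pi.single i 1) (Pi.single j 1)
    rw [sympForm_mul] at h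
    simpa [sympForm] using h
  obtain ⟨k, t, ht, hkJ, hk, hfin⟩ := core3 J hJskew hJsq μ hμ.1 hμ0 g hgJ c c'
    (by rw [Crit, hmin, add_sub_cancel_left]; exact hD)
    (by rw [Crit, hmin', add_sub_cancel_left]; exact hD')
  refine ⟨k, t, ht, ⟨unit_of_right hk, fun X Y => ?_⟩, hk, hfin⟩
  rw [sympForm_mul, hkJ]
end
end
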